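/- arXiv:1002.1763 — 11 statements merged into one kernel-verified Lean document; each statement's English description precedes it below -/
import Mathlib

section
/- For every integer n ≥ 0 and all reals p, q with 0 < p < 1 and 0 < q < 1, setting x = p/(1−p) and y = q/(1−q), one has f(n+1, p, q) − f(n, p, q) = ((1−p)(1−q))^{n+1} · ( (y + (1 + x·y)/2) · φ_n(x·y) − φ_{n+1}(x·y)/2 ). -/
/-- `f n p q` is the probability that in `n` independent tosses each, a coin with heads
probability `q` produces strictly more heads than a coin with heads probability `p`. -/
noncomputable def f (n : ℕ) (p q : ℝ) : ℝ :=
  ∑ r ∈ Finset.range (n + 1), ∑ s ∈ Finset.Icc (r + 1) n,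
    (n.choose r : ℝ) * p ^ r * (1 - p) ^ (n - r) *
      ((n.choose s : ℝ) * q ^ s * (1 - q) ^ (n - s))
/-- `phi n z = Σ_{r=0}^{n} C(n,r)^2 z^r`. -/
noncomputable def phi (n : ℕ) (z : ℝ) : ℝ :=
  ∑ r ∈ Finset.range (n + 1), (n.choose r : ℝ) ^ 2 * z ^ r

noncomputable def bA (p : ℝ) (n r : ℕ) : ℝ := (n.choose r : ℝ) * p ^ r * (1 - p) ^ (n - r)

noncomputable def bT (q : ℝ) (n r : ℕ) : ℝ := ∑ s ∈ Finset.Icc r n, bA q n s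

theorem bA_zero_of_lt (p : ℝ) {n r : ℕ} (h : n < r) : bA p n r = 0 := by
  simp [bA, Nat.choose_eq_zero_of_lt h]

theorem bA_succ_zero (p : ℝ) (n : ℕ) : bA p (n+1) 0 = (1 - p) * bA p n 0 := by
  simp [bA, pow_succ]; ring

theorem bA_succ_succ (p : ℝ) (n r : ℕ) :
    bA p (n+1) (r+1) = p * bA p n r + (1 - p) * bA p n (r+1) := by
  unfold bA
  rw [Nat.choose_succ_succ, Nat.add_sub_add_right]
  rcases Nat.lt_or_ge r n with h | h
  · obtain ⟨k, rfl⟩ := Nat.exists_eq_add_of_lt h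
    have h1 : r + k + 1 - r = k + 1 := by omega
    have h2 : r + k + 1 - (r + 1) = k := by omega
    rw [h1, h2]; push_cast; ring
  · rw [Nat.choose_eq_zero_of_lt (show n < r + 1 by omega)]
    push_cast; ring

theorem bT_rec (q : ℝ) (n r : ℕ) : bT q n r = bA q n r + bT q n (r+1) := by
  unfold bT
  rcases Nat.lt_or_ge n r with h | h
  · rw [Finset.Icc_eq_empty (by omega), Finset.Icc_eq_empty (by omega), bA_zero_of_lt q h]; simp
  · rw [← Finset.add_sum_Ioc_eq_sum_Icc h]; congr 1
    exact Finset.sum_congr (by ext; simp [Nat.succ_le_iff]) fun _ _ => rfl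

theorem bT_zero (q : ℝ) (n : ℕ) : bT q n 0 = 1 := by
  have h := add_pow q (1 - q) n
  have e : Finset.Icc 0 n = Finset.range (n+1) := by ext; simp
  rw [add_sub_cancel, one_pow] at h
  rw [h, bT, e]
  exact Finset.sum_congr rfl fun i _ => by unfold bA; ring

theorem bT_succ (q : ℝ) (n r : ℕ) : bT q (n+1) (r+1) = bT q n (r+1) + q * bA q n r := by
  induction r with
  | zero =>
    have h1 := bT_rec q (n+1) 0
    have h2 := bT_rec q n 0
    rw [bT_zero] at h1 h2
    rw [bA_succ_zero] at h1
    linarith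
  | succ r ih =>
    have h1 := bT_rec q (n+1) (r+1)
    have h2 := bT_rec q n (r+1)
    rw [bA_succ_succ] at h1
    linarith

theorem sum_shift (a g : ℕ → ℝ) (n : ℕ) (h : a (n+1) = 0) :
    ∑ r ∈ Finset.range (n+1), a r * g r
      = ∑ r ∈ Finset.range (n+1), a (r+1) * g (r+1) + a 0 * g 0 := by
  rw [← Finset.sum_range_succ' (fun r => a r * g r), Finset.sum_range_succ _ (n+1), h]; simp

theorem bA_sum (p : ℝ) (n : ℕ) (g : ℕ → ℝ) :
    ∑ r ∈ Finset.range (n+2), bA p (n+1) r * g r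
      = ∑ r ∈ Finset.range (n+1), bA p n r * (p * g (r+1) + (1-p) * g r) := by
  have h := sum_shift (bA p n) g n (bA_zero_of_lt p (by omega))
  have e : ∑ r ∈ Finset.range (n+1), bA p n r * (p * g (r+1) + (1-p) * g r)
     = ∑ r ∈ Finset.range (n+1), p * bA p n r * g (r+1)
       + (1-p) * ∑ r ∈ Finset.range (n+1), bA p n r * g r := by
    rw [Finset.mul_sum, ← Finset.sum_add_distrib]
    exact Finset.sum_congr rfl fun i _ => by ring
  rw [e, h, Finset.sum_range_succ', bA_succ_zero, mul_add, Finset.mul_sum, ← add_assoc,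
    ← Finset.sum_add_distrib, mul_assoc]
  congr 1
  exact Finset.sum_congr rfl fun i _ => by rw [bA_succ_succ]; ring

theorem f_eq (n : ℕ) (p q : ℝ) :
    f n p q = ∑ r ∈ Finset.range (n+1), bA p n r * bT q n (r+1) := by
  unfold f bT
  exact Finset.sum_congr rfl fun i _ => by rw [Finset.mul_sum]; rfl

theorem f_diff (n : ℕ) (p q : ℝ) :
    f (n+1) p q - f n p q = ∑ r ∈ Finset.range (n+1),
      bA p n r * ((1-p) * q * bA q n r - p * (1-q) * bA q n (r+1)) := by
  rw [f_eq, f_eq, bA_sum p n (fun r => bT q (n+1) (r+1)), ← Finset.sum_sub_distrib]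
  refine Finset.sum_congr rfl fun r _ => ?_
  simp only [bT_succ]
  rw [bT_rec q n (r+1)]
  ring

theorem phi_succ (n : ℕ) (z : ℝ) :
    phi (n+1) z = (1+z) * phi n z
      + 2 * z * ∑ r ∈ Finset.range (n+1), (n.choose r : ℝ) * n.choose (r+1) * z ^ r := by
  have h := sum_shift (fun r => (n.choose r : ℝ)^2) (fun r => z^r) n (by simp)
  have e : (1+z) * phi n z = phi n z + z * phi n z := by ring
  rw [e]
  nth_rewrite 2 [phi]
  rw [h]
  unfold phi
  rw [Finset.sum_range_succ', Finset.mul_sum, Finset.mul_sum]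
  have : ∀ a b c d : ℝ, a + b + c + d = (a + c + d) + b := by intros; ring
  rw [this, ← Finset.sum_add_distrib, ← Finset.sum_add_distrib]
  congr 1
  · refine Finset.sum_congr rfl fun r _ => ?_
    rw [Nat.choose_succ_succ]; push_cast; ring
  · simp

theorem bA_eq (p x : ℝ) (h : p = x * (1 - p)) (n r : ℕ) :
    bA p n r = (1-p)^n * (n.choose r * x^r) := by
  rcases Nat.lt_or_ge n r with hr | hr
  · rw [bA_zero_of_lt p hr, Nat.choose_eq_zero_of_lt hr]; simp
  · obtain ⟨k, rfl⟩ := Nat.exists_eq_add_of_le hr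
    have : p ^ r = x ^ r * (1-p)^r := by rw [← mul_pow, ← h]
    rw [bA, this, Nat.add_sub_cancel_left]; ring

theorem statement0 (n : ℕ) (p q : ℝ) (hp : 0 < p) (hp1 : p < 1) (hq : 0 < q) (hq1 : q < 1)
    (x y : ℝ) (hx : x = p / (1 - p)) (hy : y = q / (1 - q)) :
    f (n + 1) p q - f n p q =
      ((1 - p) * (1 - q)) ^ (n + 1) *
        ((y + (1 + x * y) / 2) * phi n (x * y) - phi (n + 1) (x * y) / 2) := by
  have hx' : p = x * (1 - p) := by
    rw [hx, div_mul_cancel₀]; linarith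
  have hy' : q = y * (1 - q) := by
    rw [hy, div_mul_cancel₀]; linarith
  have e : (y + (1 + x * y) / 2) * phi n (x * y) - phi (n + 1) (x * y) / 2
     = y * phi n (x*y) - x * y * ∑ r ∈ Finset.range (n+1),
        (n.choose r : ℝ) * n.choose (r+1) * (x*y) ^ r := by
    rw [phi_succ]; ring
  rw [e, f_diff, phi, Finset.mul_sum, Finset.mul_sum, ← Finset.sum_sub_distrib, Finset.mul_sum]
  refine Finset.sum_congr rfl fun r _ => ?_
  rw [bA_eq p x hx', bA_eq q y hy', bA_eq q y hy']
  have h1 : (1-p) * q = (1-p) * (1-q) * y := by linear_combination (1-p) * hy'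
  have h2 : p * (1-q) = (1-p) * (1-q) * x := by linear_combination (1-q) * hx'
  rw [h1, h2, mul_pow (1-p) (1-q)]
  ring
end

section
/- For every integer n ≥ 0 and every real z, Σ_{r=0}^{n-1} C(n,r+1) C(n,r) z^{r+1} = (1/2) · ( φ_{n+1}(z) − (1+z) · φ_n(z) ). -/
/-- `psi n z = Σ_{r=0}^{n-1} C(n,r+1) C(n,r) z^(r+1)`. -/
noncomputable def psi (n : ℕ) (z : ℝ) : ℝ :=
  ∑ r ∈ Finset.range n, (n.choose (r + 1) : ℝ) * (n.choose r : ℝ) * z ^ (r + 1)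

theorem statement1 (n : ℕ) (z : ℝ) :
    psi n z = (1 / 2) * (phi (n + 1) z - (1 + z) * phi n z) := by
  have h1 : phi (n + 1) z = 1 + ∑ r ∈ Finset.range (n + 1),
      (z * ((n.choose r : ℝ) ^ 2 * z ^ r)
        + 2 * ((n.choose (r + 1) : ℝ) * (n.choose r : ℝ) * z ^ (r + 1))
        + (n.choose (r + 1) : ℝ) ^ 2 * z ^ (r + 1)) := by
    unfold phi
    rw [Finset.sum_range_succ', add_comm]
    congr 1
    · simp
    · refine Finset.sum_congr rfl fun r _ => ?_
      rw [Nat.choose_succ_succ']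
      push_cast
      ring
  have h2 : phi n z = 1 + ∑ r ∈ Finset.range (n + 1),
      (n.choose (r + 1) : ℝ) ^ 2 * z ^ (r + 1) := by
    unfold phi
    rw [Finset.sum_range_succ', Finset.sum_range_succ]
    simp [add_comm]
  have h3 : psi n z = ∑ r ∈ Finset.range (n + 1),
      (n.choose (r + 1) : ℝ) * (n.choose r : ℝ) * z ^ (r + 1) := by
    unfold psi
    rw [Finset.sum_range_succ]
    simp
  rw [Finset.sum_add_distrib, Finset.sum_add_distrib, ← Finset.mul_sum, ← Finset.mul_sum, ← h3]
    at h1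
  change _ = 1 + (z * phi n z + _ + _) at h1
  linarith
end

section
/- For every real z with 0 < z < 1 and every integer n ≥ 0, one has φ_{n+1}(z)/φ_n(z) < φ_{n+2}(z)/φ_{n+1}(z); that is, the sequence of ratios φ_{n+1}(z)/φ_n(z) is strictly increasing in n. (Since φ_n(z) = (1−z)^n P_n((1+z)/(1−z)) with P_n the Legendre polynomial, this says that for fixed argument greater than 1 the ratios of consecutive Legendre polynomials strictly increase with n, the reversal of Turán's inequality outside the interval of orthogonality.) -/
open Polynomial in
noncomputable def ipN (N : ℕ) (P Q : ℝ[X]) : ℝ :=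
  ∑ k ∈ Finset.range N, P.coeff k * Q.coeff k

open Polynomial in
lemma ipN_comm (N : ℕ) (P Q : ℝ[X]) : ipN N P Q = ipN N Q P := by
  unfold ipN
  exact Finset.sum_congr rfl fun _ _ => mul_comm _ _

open Polynomial in
lemma ipN_add (N : ℕ) (P Q R : ℝ[X]) : ipN N (P + Q) R = ipN N P R + ipN N Q R := by
  unfold ipN
  rw [← Finset.sum_add_distrib]
  exact Finset.sum_congr rfl fun _ _ => by rw [coeff_add]; ring

open Polynomial in
lemma ipN_smul (N : ℕ) (c : ℝ) (P R : ℝ[X]) : ipN N (C c * P) R = c * ipN N P R := by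
  unfold ipN
  rw [Finset.mul_sum]
  exact Finset.sum_congr rfl fun _ _ => by rw [coeff_C_mul]; ring

open Polynomial in
lemma ipN_add' (N : ℕ) (P Q R : ℝ[X]) : ipN N R (P + Q) = ipN N R P + ipN N R Q := by
  rw [ipN_comm, ipN_add, ipN_comm N P, ipN_comm N Q]

open Polynomial in
lemma ipN_smul' (N : ℕ) (c : ℝ) (P R : ℝ[X]) : ipN N R (C c * P) = c * ipN N R P := by
  rw [ipN_comm, ipN_smul, ipN_comm N P]

open Polynomial in
lemma ipN_X (N : ℕ) (P Q : ℝ[X]) (h : P.coeff N = 0) :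
    ipN (N + 1) (X * P) (X * Q) = ipN (N + 1) P Q := by
  unfold ipN
  rw [Finset.sum_range_succ', Finset.sum_range_succ]
  simp [h, coeff_X_mul]

open Polynomial in
lemma coeff_A (s : ℝ) (n k : ℕ) :
    ((1 + C s * X) ^ n : ℝ[X]).coeff k = (n.choose k : ℝ) * s ^ k := by
  have : ((1 + C s * X) ^ n : ℝ[X]) = ((1 + X) ^ n : ℝ[X]).comp (C s * X) := by simp
  rw [this, comp_C_mul_X_coeff, coeff_one_add_X_pow]

open Polynomial in
lemma phi_ip (s : ℝ) (n d : ℕ) :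
    phi n (s ^ 2) = ipN (n + 1 + d) ((1 + C s * X) ^ n) ((1 + C s * X) ^ n) := by
  unfold ipN phi
  rw [Finset.sum_range_add _ (n + 1) d]
  simp only [coeff_A]
  rw [Finset.sum_eq_zero (s := Finset.range d)]
  · rw [add_zero]
    exact Finset.sum_congr rfl fun _ _ => by ring
  · intro i _
    rw [Nat.choose_eq_zero_of_lt (by omega)]; simp

open Polynomial in
theorem statement3 (z : ℝ) (hz0 : 0 < z) (hz1 : z < 1) (n : ℕ) :
    phi (n + 1) z / phi n z < phi (n + 2) z / phi (n + 1) z := by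
  have pos : ∀ m, 0 < phi m z := fun m => by
    unfold phi
    refine Finset.sum_pos (fun i hi => ?_) ⟨0, by simp⟩
    have : 0 < m.choose i := Nat.choose_pos (by simp at hi; omega)
    positivity
  rw [div_lt_div_iff₀ (pos _) (pos _)]
  have p0 := pos n
  obtain ⟨s, hs, rfl⟩ : ∃ s : ℝ, 0 < s ∧ z = s ^ 2 :=
    ⟨√z, Real.sqrt_pos.2 hz0, (Real.sq_sqrt hz0.le).symm⟩
  set a := phi n (s ^ 2) with ha
  set b := phi (n + 1) (s ^ 2) with hb
  set c := phi (n + 2) (s ^ 2) with hc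
  set Q : ℝ[X] := (1 + C s * X) ^ n with hQ
  set R : ℝ[X] := (1 + C s * X) ^ (n + 1) with hR
  have hRQ : R = Q + C s * (X * Q) := by rw [hR, pow_succ, ← hQ]; ring
  have hRR : ((1 + C s * X) ^ (n + 2) : ℝ[X]) = R + C s * (X * R) := by
    rw [pow_succ, ← hR]; ring
  have q0 : Q.coeff (n + 2 + 1) = 0 := by
    rw [hQ, coeff_A, Nat.choose_eq_zero_of_lt (by omega)]; simp
  have r0 : R.coeff (n + 2 + 1) = 0 := by
    rw [hR, coeff_A, Nat.choose_eq_zero_of_lt (by omega)]; simp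
  have ea : a = ipN (n + 2 + 1 + 1) Q Q := phi_ip s n 3
  have eb : b = ipN (n + 2 + 1 + 1) R R := phi_ip s (n + 1) 2
  have ec : c = ipN (n + 2 + 1 + 1) (R + C s * (X * R)) (R + C s * (X * R)) := by
    rw [← hRR]; exact phi_ip s (n + 2) 1
  set u : ℝ[X] := X * R + C s * R with hu
  set v : ℝ[X] := X * Q with hv
  have vv : ipN (n + 2 + 1 + 1) v v = a := by rw [ea, hv, ipN_X _ _ _ q0]
  have uv : ipN (n + 2 + 1 + 1) u v = b := by
    rw [eb]
    nth_rewrite 2 [hRQ]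
    rw [hu, hv, ipN_add, ipN_smul, ipN_X _ _ _ r0, ipN_add', ipN_smul']
  have uu : ipN (n + 2 + 1 + 1) u u = c := by
    rw [ec, hu]
    simp only [ipN_add, ipN_add', ipN_smul, ipN_smul', ipN_X _ _ _ r0]
    ring
  have key : 0 < ipN (n + 2 + 1 + 1) (C a * u + C (-b) * v) (C a * u + C (-b) * v) := by
    unfold ipN
    refine Finset.sum_pos' (fun i _ => mul_self_nonneg _) ⟨0, by simp, ?_⟩
    apply mul_self_pos.2
    have : R.coeff 0 = 1 := by rw [hR, coeff_A]; simp
    have : (C a * u + C (-b) * v).coeff 0 = a * s := by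
      simp only [hu, hv, coeff_add, coeff_C_mul, coeff_X_mul_zero, this]; ring
    rw [this]; positivity
  simp only [ipN_add, ipN_add', ipN_smul, ipN_smul', vv, uv, uu, ipN_comm _ v u] at key
  have : 0 < a * (c * a - b * b) := by linarith
  have := (mul_pos_iff_of_pos_left p0).1 this
  linarith
end

section
/- For all reals p, q with 0 < q < p < 1, there exists an integer N ≥ 1 such that: (i) for all n < N, f(n, p, q) < f(n+1, p, q); (ii) f(N+1, p, q) ≤ f(N, p, q); and (iii) for all n > N, f(n+1, p, q) < f(n, p, q). In particular f(·, p, q) attains its maximum at exactly one value of n or at two consecutive values of n. -/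
noncomputable def bw (n : ℕ) (p : ℝ) (r : ℕ) : ℝ := (n.choose r : ℝ) * p ^ r * (1 - p) ^ (n - r)

noncomputable def EE (n : ℕ) (p q : ℝ) (h : ℤ → ℝ) : ℝ :=
  ∑ r ∈ Finset.range (n + 1), ∑ s ∈ Finset.range (n + 1), bw n p r * bw n q s * h ((s : ℤ) - r)

lemma bw_rec (n : ℕ) (p : ℝ) (g : ℕ → ℝ) :
    ∑ r ∈ Finset.range (n + 2), bw (n + 1) p r * g r =
      ∑ r ∈ Finset.range (n + 1), bw n p r * ((1 - p) * g r + p * g (r + 1)) := by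
  have h0 : ∀ r, bw (n + 1) p (r + 1) = p * bw n p r + (1 - p) * bw n p (r + 1) := by
    intro r
    unfold bw
    rw [Nat.choose_succ_succ]
    rcases lt_or_ge r n with h | h
    · obtain ⟨d, rfl⟩ := Nat.exists_eq_add_of_lt h
      have e1 : r + d + 1 + 1 - (r + 1) = d + 1 := by omega
      have e2 : r + d + 1 - r = d + 1 := by omega
      have e3 : r + d + 1 - (r + 1) = d := by omega
      rw [e1, e2, e3]
      push_cast
      ring
    · rw [Nat.choose_eq_zero_of_lt (show n < r + 1 by omega)]
      have e1 : n + 1 - (r + 1) = n - r := by omega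
      rw [e1]
      push_cast
      ring
  have h1 : bw (n + 1) p 0 = (1 - p) * bw n p 0 := by
    unfold bw
    simp
    ring
  have h2 : bw n p (n + 1) = 0 := by
    unfold bw
    simp
  rw [Finset.sum_range_succ']
  have h3 : ∑ r ∈ Finset.range (n + 1), bw n p r * ((1 - p) * g r) =
      ∑ r ∈ Finset.range (n + 1), (1 - p) * bw n p (r + 1) * g (r + 1)
        + (1 - p) * bw n p 0 * g 0 := by
    have := Finset.sum_range_succ' (fun r => bw n p r * ((1 - p) * g r)) (n + 1)
    rw [Finset.sum_range_succ, h2] at this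
    rw [zero_mul, add_zero] at this
    rw [this]
    congr 1
    · apply Finset.sum_congr rfl; intros; ring
    · ring
  simp only [mul_add, Finset.sum_add_distrib]
  rw [h3, h1]
  simp only [h0, add_mul, Finset.sum_add_distrib]
  have : ∑ x ∈ Finset.range (n + 1), p * bw n p x * g (x + 1) =
    ∑ x ∈ Finset.range (n + 1), bw n p x * (p * g (x + 1)) := by
    apply Finset.sum_congr rfl; intros; ring
  rw [this]
  ring

lemma EE_alt (n : ℕ) (p q : ℝ) (h : ℤ → ℝ) : EE n p q h =
    ∑ r ∈ Finset.range (n + 1), bw n p r *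
      ∑ s ∈ Finset.range (n + 1), bw n q s * h ((s : ℤ) - r) := by
  unfold EE
  simp only [Finset.mul_sum, mul_assoc]

lemma EE_rec (n : ℕ) (p q : ℝ) (h : ℤ → ℝ) :
    EE (n + 1) p q h = EE n p q (fun k => (p * q + (1 - p) * (1 - q)) * h k
      + q * (1 - p) * h (k + 1) + p * (1 - q) * h (k - 1)) := by
  rw [EE_alt, bw_rec, EE_alt]
  apply Finset.sum_congr rfl
  intro r _
  congr 1
  rw [bw_rec n q (fun s => h ((s : ℤ) - r)), bw_rec n q (fun s => h ((s : ℤ) - (r + 1 : ℕ)))]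
  simp only [Finset.mul_sum]
  rw [← Finset.sum_add_distrib]
  apply Finset.sum_congr rfl
  intro s _
  have e1 : ((s + 1 : ℕ) : ℤ) - r = (s : ℤ) - r + 1 := by push_cast; ring
  have e2 : ((s : ℕ) : ℤ) - (r + 1 : ℕ) = (s : ℤ) - r - 1 := by push_cast; ring
  have e3 : ((s + 1 : ℕ) : ℤ) - (r + 1 : ℕ) = (s : ℤ) - r := by push_cast; ring
  rw [e1, e2, e3]
  ring

lemma EE_zero (p q : ℝ) (h : ℤ → ℝ) : EE 0 p q h = h 0 := by
  simp [EE, bw]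

lemma EE_add (n : ℕ) (p q : ℝ) (h g : ℤ → ℝ) :
    EE n p q (fun k => h k + g k) = EE n p q h + EE n p q g := by
  simp only [EE, mul_add, Finset.sum_add_distrib]

lemma EE_smul (n : ℕ) (p q x : ℝ) (h : ℤ → ℝ) :
    EE n p q (fun k => x * h k) = x * EE n p q h := by
  simp only [EE, Finset.mul_sum]
  apply Finset.sum_congr rfl; intros; apply Finset.sum_congr rfl; intros; ring

lemma bw_nonneg (n : ℕ) (p : ℝ) (hp : 0 < p) (hp1 : p < 1) (r : ℕ) : 0 ≤ bw n p r := by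
  have : 0 < 1 - p := by linarith
  unfold bw
  positivity

lemma EE_mono (n : ℕ) (p q : ℝ) (hp : 0 < p) (hp1 : p < 1) (hq : 0 < q) (hq1 : q < 1)
    (h g : ℤ → ℝ) (hg : ∀ k, h k ≤ g k) : EE n p q h ≤ EE n p q g := by
  unfold EE
  apply Finset.sum_le_sum; intro r _; apply Finset.sum_le_sum; intro s _
  exact mul_le_mul_of_nonneg_left (hg _) (mul_nonneg (bw_nonneg n p hp hp1 r) (bw_nonneg n q hq hq1 s))

lemma f_eq_s4 (n : ℕ) (p q : ℝ) : f n p q = EE n p q (fun k => if 0 < k then 1 else 0) := by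
  unfold f EE
  apply Finset.sum_congr rfl; intro r _
  have : Finset.Icc (r + 1) n = (Finset.range (n + 1)).filter (fun s : ℕ => 0 < (s : ℤ) - r) := by
    ext s
    simp only [Finset.mem_Icc, Finset.mem_filter, Finset.mem_range]
    omega
  rw [this, Finset.sum_filter]
  apply Finset.sum_congr rfl; intro s _
  simp only [bw]
  split_ifs <;> simp

/-- eigenfunctions -/
lemma EE_eigen (n : ℕ) (p q w : ℝ) (h : ℤ → ℝ) (hh : ∀ k, (p * q + (1 - p) * (1 - q)) * h k
      + q * (1 - p) * h (k + 1) + p * (1 - q) * h (k - 1) = w * h k) :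
    EE n p q h = w ^ n * h 0 := by
  induction n with
  | zero => rw [EE_zero]; simp
  | succ n ih =>
    rw [EE_rec]
    simp only [hh]
    rw [EE_smul, ih]
    ring

lemma EE_odd (n : ℕ) (p q ρ t : ℝ) (hρ : ρ ≠ 0) (h1 : q * (1 - p) * ρ = t)
    (h2 : p * (1 - q) = t * ρ) (g : ℤ → ℝ) (hg : ∀ k, g (-k) = - g k) :
    EE n p q (fun k => ρ ^ k * g k) = 0 := by
  induction n generalizing g with
  | zero =>
    rw [EE_zero]
    have := hg 0
    simp at this
    have : g 0 = 0 := by linarith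
    simp [this]
  | succ n ih =>
    rw [EE_rec]
    have := ih (fun k => (p * q + (1 - p) * (1 - q)) * g k + t * (g (k + 1) + g (k - 1))) (by
      intro k
      have e1 : -k + 1 = -(k - 1) := by ring
      have e2 : -k - 1 = -(k + 1) := by ring
      simp only [e1, e2, hg]
      ring)
    rw [← this]
    congr 1
    funext k
    rw [zpow_add_one₀ hρ, zpow_sub_one₀ hρ, h2, ← h1]
    field_simp
    ring

lemma cos_int (k : ℤ) : ∫ θ in (0 : ℝ)..(2 * Real.pi), Real.cos (k * θ) =
    2 * Real.pi * (if k = 0 then 1 else 0) := by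
  split_ifs with h
  · subst h; simp
  · have hk : (k : ℝ) ≠ 0 := by exact_mod_cast h
    rw [intervalIntegral.integral_comp_mul_left (fun x => Real.cos x) hk, integral_cos]
    have : Real.sin (k * (2 * Real.pi)) = 0 := by
      have := Real.sin_int_mul_pi (k * 2)
      push_cast at this
      rw [← this]; ring_nf
    simp [this]

/-- the return probability -/
noncomputable def AA (n : ℕ) (p q : ℝ) : ℝ := EE n p q (fun k => if k = 0 then 1 else 0)

lemma AA_int (n : ℕ) (p q ρ t : ℝ) (hρ : ρ ≠ 0) (h1 : q * (1 - p) * ρ = t)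
    (h2 : p * (1 - q) = t * ρ) :
    2 * Real.pi * AA n p q = ∫ θ in (0 : ℝ)..(2 * Real.pi),
      (p * q + (1 - p) * (1 - q) + 2 * t * Real.cos θ) ^ n := by
  have key : ∀ θ : ℝ, (p * q + (1 - p) * (1 - q) + 2 * t * Real.cos θ) ^ n =
      EE n p q (fun k => ρ ^ k * Real.cos (k * θ)) := by
    intro θ
    rw [EE_eigen n p q (p * q + (1 - p) * (1 - q) + 2 * t * Real.cos θ)]
    · simp
    · intro k
      rw [zpow_add_one₀ hρ, zpow_sub_one₀ hρ, h2, ← h1]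
      push_cast
      rw [show ((k : ℝ) + 1) * θ = k * θ + θ by ring, show ((k : ℝ) - 1) * θ = k * θ - θ by ring,
        Real.cos_add, Real.cos_sub]
      field_simp
      ring
  simp only [key]
  unfold EE AA
  rw [intervalIntegral.integral_finsetSum]
  · unfold EE
    rw [Finset.mul_sum]
    apply Finset.sum_congr rfl; intro r _
    rw [intervalIntegral.integral_finsetSum]
    · rw [Finset.mul_sum]
      apply Finset.sum_congr rfl; intro s _
      rw [intervalIntegral.integral_const_mul, intervalIntegral.integral_const_mul, cos_int]
      by_cases h : (s : ℤ) - r = 0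
      · simp [h]; ring
      · simp [h]
    · intro s _
      apply Continuous.intervalIntegrable
      fun_prop
  · intro r _
    apply Continuous.intervalIntegrable
    fun_prop

lemma wint_pos (c t x : ℝ) (n : ℕ) (ht : 0 < t) (hc : 2 * t ≤ c) :
    0 < ∫ θ in (0 : ℝ)..(2 * Real.pi),
      (c + 2 * t * Real.cos θ) ^ n * (c + 2 * t * Real.cos θ - x) ^ 2 := by
  have hw : ∀ θ, 0 ≤ c + 2 * t * Real.cos θ := by
    intro θ
    nlinarith [Real.neg_one_le_cos θ]
  have hpi := Real.pi_pos
  apply intervalIntegral.integral_pos (by positivity)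
  · fun_prop
  · intro θ _
    exact mul_nonneg (pow_nonneg (hw θ) n) (sq_nonneg _)
  · by_cases hx : c + 2 * t = x
    · refine ⟨Real.pi / 2, ⟨by positivity, by linarith⟩, ?_⟩
      rw [Real.cos_pi_div_two]
      have : 0 < c := by linarith
      have h2 : c + 2 * t * 0 - x ≠ 0 := by intro h; linarith
      have h3 : 0 < c + 2 * t * 0 := by linarith
      positivity
    · refine ⟨0, ⟨le_refl _, by positivity⟩, ?_⟩
      rw [Real.cos_zero]
      have h2 : c + 2 * t * 1 - x ≠ 0 := by intro h; apply hx; linarith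
      have h3 : 0 < c + 2 * t * 1 := by linarith
      positivity

lemma wint_pos' (c t : ℝ) (n : ℕ) (ht : 0 < t) (hc : 2 * t ≤ c) :
    0 < ∫ θ in (0 : ℝ)..(2 * Real.pi), (c + 2 * t * Real.cos θ) ^ n := by
  have hw : ∀ θ, 0 ≤ c + 2 * t * Real.cos θ := by
    intro θ
    nlinarith [Real.neg_one_le_cos θ]
  have hpi := Real.pi_pos
  apply intervalIntegral.integral_pos (by positivity)
  · fun_prop
  · intro θ _
    exact pow_nonneg (hw θ) n
  · refine ⟨0, ⟨le_refl _, by positivity⟩, ?_⟩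
    rw [Real.cos_zero]
    have h3 : 0 < c + 2 * t * 1 := by linarith
    positivity

lemma wint_expand (c t x : ℝ) (n : ℕ) :
    ∫ θ in (0 : ℝ)..(2 * Real.pi),
      (c + 2 * t * Real.cos θ) ^ n * (c + 2 * t * Real.cos θ - x) ^ 2 =
    (∫ θ in (0 : ℝ)..(2 * Real.pi), (c + 2 * t * Real.cos θ) ^ (n + 2))
    - 2 * x * (∫ θ in (0 : ℝ)..(2 * Real.pi), (c + 2 * t * Real.cos θ) ^ (n + 1))
    + x ^ 2 * (∫ θ in (0 : ℝ)..(2 * Real.pi), (c + 2 * t * Real.cos θ) ^ n) := by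
  rw [← intervalIntegral.integral_const_mul, ← intervalIntegral.integral_const_mul,
    ← intervalIntegral.integral_sub, ← intervalIntegral.integral_add]
  · congr 1
    funext θ
    ring
  all_goals
    apply Continuous.intervalIntegrable
    fun_prop

theorem statement4 (p q : ℝ) (hq : 0 < q) (hqp : q < p) (hp1 : p < 1) :
    ∃ N : ℕ, 1 ≤ N ∧
      (∀ n : ℕ, n < N → f n p q < f (n + 1) p q) ∧
      f (N + 1) p q ≤ f N p q ∧
      (∀ n : ℕ, N < n → f (n + 1) p q < f n p q) := by
  have hp : 0 < p := hq.trans hqp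
  have hq1 : q < 1 := hqp.trans hp1
  have hp' : 0 < 1 - p := by linarith
  have hq' : 0 < 1 - q := by linarith
  obtain ⟨a, ha⟩ : ∃ a, a = q * (1 - p) := ⟨_, rfl⟩
  obtain ⟨b, hb⟩ : ∃ b, b = p * (1 - q) := ⟨_, rfl⟩
  obtain ⟨c, hc⟩ : ∃ c, c = p * q + (1 - p) * (1 - q) := ⟨_, rfl⟩
  have ha0 : 0 < a := by rw [ha]; positivity
  have hab : a < b := by rw [ha, hb]; nlinarith
  have hb0 : 0 < b := ha0.trans hab
  have hsum : a + b + c = 1 := by rw [ha, hb, hc]; ring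
  have hc0 : 0 < c := by rw [hc]; positivity
  set ρ := Real.sqrt (b / a) with hρd
  have hρ2 : ρ ^ 2 = b / a := Real.sq_sqrt (by positivity)
  have hρ1 : 1 < ρ := by
    rw [hρd]
    apply Real.lt_sqrt_of_sq_lt
    rw [lt_div_iff₀ ha0]; linarith
  have hρ0 : 0 < ρ := by linarith
  obtain ⟨t, ht⟩ : ∃ t, t = a * ρ := ⟨_, rfl⟩
  have ht0 : 0 < t := by rw [ht]; positivity
  have haρ : a * ρ ^ 2 = b := by rw [hρ2]; field_simp
  have htb : b = t * ρ := by rw [ht, ← haρ]; ring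
  have ht2 : t ^ 2 = a * b := by rw [ht, ← haρ]; ring
  have h1 : q * (1 - p) * ρ = t := by rw [ht, ha]
  have h2 : p * (1 - q) = t * ρ := by rw [← htb, hb]
  have htc : 2 * t ≤ c := by
    apply le_of_sq_le_sq _ hc0.le
    have : (2 * t) ^ 2 = 4 * (a * b) := by rw [← ht2]; ring
    rw [this, ha, hb, hc]
    nlinarith [sq_nonneg (p * q - (1 - p) * (1 - q))]
  have ht1 : c + 2 * t < 1 := by
    have : 2 * t < a + b := by
      have : a + b - 2 * t = a * (ρ - 1) ^ 2 := by rw [ht, ← haρ]; ring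
      have : 0 < a * (ρ - 1) ^ 2 := by
        have : 0 < ρ - 1 := by linarith
        positivity
      linarith
    linarith
  have hA := fun n => AA_int n p q ρ t hρ0.ne' h1 h2
  rw [← hc] at hA
  have hpi := Real.pi_pos
  have hApos : ∀ n, 0 < AA n p q := by
    intro n
    have := wint_pos' c t n ht0 htc
    rw [← hA] at this
    exact pos_of_mul_pos_right this (by positivity)
  have hquad : ∀ n x, 0 < AA (n + 2) p q - 2 * x * AA (n + 1) p q + x ^ 2 * AA n p q := by
    intro n x
    have := wint_pos c t x n ht0 htc
    rw [wint_expand, ← hA, ← hA, ← hA] at this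
    have h : 0 < 2 * Real.pi * (AA (n + 2) p q - 2 * x * AA (n + 1) p q + x ^ 2 * AA n p q) := by
      linarith
    exact pos_of_mul_pos_right h (by positivity)
  have hconv : ∀ n, AA (n + 1) p q ^ 2 < AA (n + 2) p q * AA n p q := by
    intro n
    have h := hquad n (AA (n + 1) p q / AA n p q)
    have h0 := hApos n
    have h3 := mul_pos h h0
    have : (AA (n + 2) p q - 2 * (AA (n + 1) p q / AA n p q) * AA (n + 1) p q +
      (AA (n + 1) p q / AA n p q) ^ 2 * AA n p q) * AA n p q =
      AA (n + 2) p q * AA n p q - AA (n + 1) p q ^ 2 := by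
      field_simp
      ring
    linarith
  have hdiff : ∀ n, 2 * (f (n + 1) p q - f n p q) = (2 * a + c) * AA n p q - AA (n + 1) p q := by
    intro n
    have hB := EE_odd n p q ρ t hρ0.ne' h1 h2
      (fun k => (if k = 1 then 1 else 0) - (if k = -1 then 1 else 0)) (by
        intro k
        have e1 : (-k = 1) ↔ (k = -1) := by omega
        have e2 : (-k = -1) ↔ (k = 1) := by omega
        simp only [e1, e2]
        ring)
    have hB' : EE n p q (fun k => ρ ^ k * ((if k = 1 then 1 else 0) - (if k = -1 then 1 else 0))) =
      ρ * EE n p q (fun k => if k = 1 then 1 else 0)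
        + (-ρ⁻¹) * EE n p q (fun k => if k = -1 then 1 else 0) := by
      rw [← EE_smul, ← EE_smul, ← EE_add]
      congr 1
      funext k
      by_cases hk : k = 1
      · subst hk; simp
      · by_cases hk' : k = -1
        · subst hk'; simp
        · simp [hk, hk']
    rw [hB'] at hB
    have hrev : b * EE n p q (fun k => if k = 1 then 1 else 0) =
        a * EE n p q (fun k => if k = -1 then 1 else 0) := by
      rw [← haρ]
      field_simp at hB
      linear_combination a * hB
    have hA1 : AA (n + 1) p q = c * AA n p q + a * EE n p q (fun k => if k = -1 then 1 else 0)
        + b * EE n p q (fun k => if k = 1 then 1 else 0) := by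
      unfold AA
      rw [EE_rec, ← EE_smul, ← EE_smul, ← EE_smul, ← EE_add, ← EE_add, ← ha, ← hb, ← hc]
      congr 1
      funext k
      have e1 : (k + 1 = 0) ↔ (k = -1) := by omega
      have e2 : (k - 1 = 0) ↔ (k = 1) := by omega
      simp only [e1, e2]
    have hf1 : f (n + 1) p q = f n p q + a * AA n p q
        + (-b) * EE n p q (fun k => if k = 1 then 1 else 0) := by
      rw [f_eq_s4, f_eq_s4]
      unfold AA
      rw [EE_rec, ← EE_smul, ← EE_smul, ← EE_add, ← EE_add, ← ha, ← hb, ← hc]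
      congr 1
      funext k
      rcases lt_trichotomy k 0 with hk | hk | hk
      · have e1 : ¬ (0 < k) := by omega
        have e2 : ¬ (0 < k + 1) := by omega
        have e3 : ¬ (0 < k - 1) := by omega
        have e4 : ¬ (k = 0) := by omega
        have e5 : ¬ (k = 1) := by omega
        simp only [e1, e2, e3, e4, e5, if_false]; ring
      · subst hk; simp
      · by_cases hk1 : k = 1
        · subst hk1; simp; linarith
        · have e2 : (0 < k + 1) := by omega
          have e3 : (0 < k - 1) := by omega
          have e4 : ¬ (k = 0) := by omega
          simp only [hk, e2, e3, e4, hk1, if_true, if_false]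
          linarith
    rw [hf1, hA1]
    linear_combination -hrev
  have hf01 : f 0 p q < f 1 p q := by
    have e0 : f 0 p q = 0 := by rw [f_eq_s4, EE_zero]; simp
    have e1 : f 1 p q = a := by
      rw [f_eq_s4, EE_rec, EE_zero, ha]; simp
    rw [e0, e1]; exact ha0
  have hf0 : f 0 p q = 0 := by rw [f_eq_s4, EE_zero]; simp
  have hbound : ∀ n, f n p q ≤ (c + 2 * t) ^ n := by
    intro n
    have h := EE_eigen n p q (c + 2 * t) (fun k => ρ ^ k) (by
      intro k
      rw [zpow_add_one₀ hρ0.ne', zpow_sub_one₀ hρ0.ne', h2, ← hc, ← h1]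
      field_simp
      ring)
    simp at h
    rw [f_eq_s4, ← h]
    apply EE_mono n p q hp hp1 hq hq1
    intro k
    split_ifs with hk
    · exact one_le_zpow₀ hρ1.le hk.le
    · positivity
  have hex : ∃ N, f (N + 1) p q ≤ f N p q := by
    by_contra hcon
    push Not at hcon
    have hmono : StrictMono (fun n => f n p q) := strictMono_nat_of_lt_succ hcon
    obtain ⟨n, hn⟩ := exists_pow_lt_of_lt_one (show 0 < f 1 p q by linarith) ht1
    have h3 : f n p q < f 1 p q := (hbound n).trans_lt hn
    have h4 := hmono.lt_iff_lt.mp h3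
    have : n = 0 := by omega
    subst this
    have h5 := hmono.monotone
    have h6 : f 1 p q ≤ 1 := by
      have := hbound 1
      simp at this
      linarith
    simp at hn
    linarith
  classical
  refine ⟨Nat.find hex, ?_, ?_, Nat.find_spec hex, ?_⟩
  · rw [Nat.one_le_iff_ne_zero]
    intro h0
    have := Nat.find_spec hex
    rw [h0] at this
    simp at this
    linarith
  · intro n hn
    exact not_le.mp (Nat.find_min hex hn)
  · have hl : 0 < 2 * a + c := by linarith
    have hstep : ∀ n, f (n + 1) p q ≤ f n p q → f (n + 2) p q < f (n + 1) p q := by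
      intro n hn
      have d1 := hdiff n
      have d2 := hdiff (n + 1)
      have g1 : (2 * a + c) * AA n p q ≤ AA (n + 1) p q := by linarith
      have g2 : (2 * a + c) * AA (n + 1) p q < AA (n + 2) p q := by
        have := hconv n
        have h0 := hApos n
        have h1 := hApos (n + 1)
        refine lt_of_mul_lt_mul_right ?_ h0.le
        nlinarith
      have d2' : 2 * (f (n + 2) p q - f (n + 1) p q) =
        (2 * a + c) * AA (n + 1) p q - AA (n + 2) p q := d2
      linarith
    intro n hn
    induction n, hn using Nat.le_induction with
    | base => exact hstep _ (Nat.find_spec hex)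
    | succ n _ ih => exact hstep _ ih.le
end

section
/- For every real q with 0 < q < 1/2 and every integer n ≥ 0, with p = 1 − q one has f(n+1, p, q) − f(n, p, q) = (q(1−q))^{n+1} · C(2n, n) · ( q/(1−q) − n/(n+1) ). In particular the difference is positive, zero, or negative according as q/(1−q) is greater than, equal to, or less than n/(n+1). -/
noncomputable def bb (q : ℝ) (m k : ℕ) : ℝ := (m.choose k : ℝ) * q ^ k * (1 - q) ^ (m - k)

noncomputable def tt (q : ℝ) (m k : ℕ) : ℝ := ∑ j ∈ Finset.Ico k (m + 1), bb q m j

lemma bb_zero (q : ℝ) (m k : ℕ) (h : m < k) : bb q m k = 0 := by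
  simp [bb, Nat.choose_eq_zero_of_lt h]

lemma bb_succ (q : ℝ) (m k : ℕ) :
    bb q (m + 1) (k + 1) = q * bb q m k + (1 - q) * bb q m (k + 1) := by
  rcases lt_or_ge m (k + 1) with h | h
  · rw [bb_zero q m (k + 1) h]
    simp only [bb, Nat.choose_succ_succ, Nat.choose_eq_zero_of_lt h, Nat.succ_eq_add_one,
      Nat.add_sub_add_right]
    push_cast
    ring
  · obtain ⟨d, rfl⟩ := Nat.exists_eq_add_of_le h
    simp only [bb, Nat.choose_succ_succ, Nat.succ_eq_add_one, Nat.add_sub_add_right]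
    have h1 : k + 1 + d - k = d + 1 := by omega
    have h2 : k + 1 + d - (k + 1) = d := by omega
    rw [h1, h2]
    push_cast
    ring

lemma tt_step (q : ℝ) (m k : ℕ) (h : k ≤ m) : tt q m k = bb q m k + tt q m (k + 1) := by
  unfold tt
  rw [Finset.sum_eq_sum_Ico_succ_bot (by omega)]

lemma tt_succ (q : ℝ) (m k : ℕ) (h : k ≤ m) :
    tt q (m + 1) (k + 1) = tt q m (k + 1) + q * bb q m k := by
  have h1 : tt q (m + 1) (k + 1) = q * tt q m k + (1 - q) * tt q m (k + 1) := by
    unfold tt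
    rw [← Finset.sum_Ico_add' (fun j => bb q (m + 1) j) k (m + 1) 1]
    simp only [bb_succ, Finset.sum_add_distrib, ← Finset.mul_sum]
    rw [Finset.sum_Ico_add' (fun j => bb q m j) k (m + 1) 1,
      Finset.sum_Ico_succ_top (by omega : k + 1 ≤ m + 1), bb_zero q m (m + 1) (by omega), add_zero]
  rw [h1, tt_step q m k h]
  ring

lemma bb_conv (q : ℝ) (n k : ℕ) :
    ∑ x ∈ Finset.HasAntidiagonal.antidiagonal k, bb q n x.1 * bb q n x.2 = bb q (2 * n) k := by
  have h := Nat.add_choose_eq n n k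
  rw [← two_mul] at h
  unfold bb
  rw [h]
  push_cast
  rw [Finset.sum_mul, Finset.sum_mul]
  refine Finset.sum_congr rfl fun x hx => ?_
  rw [Finset.HasAntidiagonal.mem_antidiagonal] at hx
  rcases lt_or_ge n x.1 with h1 | h1
  · simp [Nat.choose_eq_zero_of_lt h1]
  rcases lt_or_ge n x.2 with h2 | h2
  · simp [Nat.choose_eq_zero_of_lt h2]
  have : 2 * n - k = (n - x.1) + (n - x.2) := by omega
  rw [this, ← hx, pow_add, pow_add]
  ring

lemma f_eq_s5 (q : ℝ) (n : ℕ) : f n (1 - q) q = tt q (2 * n) (n + 1) := by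
  have h1 : f n (1 - q) q = ∑ r ∈ Finset.range (n + 1), ∑ s ∈ Finset.range (n + 1),
      if n < r + s then bb q n r * bb q n s else 0 := by
    unfold f
    rw [← Finset.sum_range_reflect]
    refine Finset.sum_congr rfl fun r hr => ?_
    rw [Finset.mem_range] at hr
    rw [← Finset.sum_filter]
    refine Finset.sum_congr ?_ fun s hs => ?_
    · ext s
      simp only [Finset.mem_Icc, Finset.mem_filter, Finset.mem_range]
      omega
    · have e1 : n + 1 - 1 - r = n - r := by omega
      have e2 : n - (n - r) = r := by omega
      rw [e1, e2, Nat.choose_symm (by omega)]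
      unfold bb
      ring
  rw [h1, ← Finset.sum_product', ← Finset.sum_filter]
  unfold tt
  rw [← Finset.sum_fiberwise_of_maps_to (t := Finset.Ico (n + 1) (2 * n + 1))
    (g := fun x : ℕ × ℕ => x.1 + x.2)]
  · refine Finset.sum_congr rfl fun k hk => ?_
    rw [← bb_conv]
    rw [Finset.mem_Ico] at hk
    refine Finset.sum_subset ?_ ?_
    · intro x hx
      simp only [Finset.mem_filter] at hx
      simpa using hx.2
    · intro x hx hx'
      rw [Finset.HasAntidiagonal.mem_antidiagonal] at hx
      simp only [Finset.mem_filter, Finset.mem_product, Finset.mem_range] at hx'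
      rcases lt_or_ge n x.1 with h1 | h1
      · simp [bb_zero q n _ h1]
      rcases lt_or_ge n x.2 with h2 | h2
      · simp [bb_zero q n _ h2]
      exfalso
      apply hx'
      omega
  · intro x hx
    simp only [Finset.mem_filter, Finset.mem_product, Finset.mem_range] at hx
    simp only [Finset.mem_Ico]
    omega

theorem statement5 (q : ℝ) (hq : 0 < q) (hq2 : q < 1 / 2) (n : ℕ) :
    f (n + 1) (1 - q) q - f n (1 - q) q =
      (q * (1 - q)) ^ (n + 1) * ((2 * n).choose n : ℝ) *
        (q / (1 - q) - (n : ℝ) / (n + 1)) := by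
  have hp : (1 - q) ≠ 0 := by linarith
  have hn : (n : ℝ) + 1 ≠ 0 := by positivity
  rw [f_eq_s5, f_eq_s5, show 2 * (n + 1) = 2 * n + 1 + 1 by ring]
  have a1 := tt_succ q (2 * n + 1) (n + 1) (by omega)
  have a2 := tt_step q (2 * n + 1) (n + 1) (by omega)
  have a3 := tt_succ q (2 * n) n (by omega)
  have a4 := bb_succ q (2 * n) n
  have key : tt q (2 * n + 1 + 1) (n + 1 + 1) - tt q (2 * n) (n + 1) =
      q ^ 2 * bb q (2 * n) n - (1 - q) * ((1 - q) * bb q (2 * n) (n + 1)) := by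
    rw [a4] at a1 a2
    linear_combination a1 - a2 + a3
  rw [key]
  have c : ((2 * n).choose (n + 1) : ℝ) = ((2 * n).choose n : ℝ) * (n / (n + 1)) := by
    have := Nat.choose_succ_right_eq (2 * n) n
    rw [show 2 * n - n = n by omega] at this
    have h' : ((2 * n).choose (n + 1) : ℝ) * (n + 1) = ((2 * n).choose n : ℝ) * n := by
      exact_mod_cast this
    field_simp
    linarith
  have d : (1 - q) * bb q (2 * n) (n + 1) =
      ((2 * n).choose (n + 1) : ℝ) * q ^ (n + 1) * (1 - q) ^ n := by
    rcases n with _ | n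
    · simp [bb]
    · unfold bb
      rw [show 2 * (n + 1) - (n + 1 + 1) = n by omega]
      ring
  rw [d, c]
  unfold bb
  rw [show 2 * n - n = n by omega, mul_pow]
  field_simp
  ring
end

section
/- (Symmetry) For every integer n ≥ 0 and all reals p, q with 0 < p < 1 and 0 < q < 1, one has f(n, p, q) = f(n, 1−q, 1−p). -/
theorem statement10 (n : ℕ) (p q : ℝ) (hp : 0 < p) (hp1 : p < 1) (hq : 0 < q) (hq1 : q < 1) :
    f n p q = f n (1 - q) (1 - p) := by
  unfold f
  rw [Finset.sum_sigma', Finset.sum_sigma']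
  refine Finset.sum_bij' (fun x _ => (⟨n - x.2, n - x.1⟩ : (_ : ℕ) × ℕ))
    (fun x _ => (⟨n - x.2, n - x.1⟩ : (_ : ℕ) × ℕ)) ?_ ?_ ?_ ?_ ?_
  · rintro ⟨r, s⟩ h
    simp only [Finset.mem_sigma, Finset.mem_range, Finset.mem_Icc] at h ⊢
    omega
  · rintro ⟨r, s⟩ h
    simp only [Finset.mem_sigma, Finset.mem_range, Finset.mem_Icc] at h ⊢
    omega
  · rintro ⟨r, s⟩ h
    simp only [Finset.mem_sigma, Finset.mem_range, Finset.mem_Icc] at h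
    have h1 : n - (n - r) = r := by omega
    have h2 : n - (n - s) = s := by omega
    simp only [h1, h2]
  · rintro ⟨r, s⟩ h
    simp only [Finset.mem_sigma, Finset.mem_range, Finset.mem_Icc] at h
    have h1 : n - (n - r) = r := by omega
    have h2 : n - (n - s) = s := by omega
    simp only [h1, h2]
  · rintro ⟨r, s⟩ h
    simp only [Finset.mem_sigma, Finset.mem_range, Finset.mem_Icc] at h
    have h1 : n - (n - r) = r := by omega
    have h2 : n - (n - s) = s := by omega
    have hr : r ≤ n := by omega
    have hs : s ≤ n := by omega
    simp only [h1, h2, Nat.choose_symm hr, Nat.choose_symm hs, sub_sub_cancel]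
    ring
end

section
/- (Generating function) For all reals p, q with 0 < p < 1 and 0 < q < 1, there exists ε > 0 such that for every real t with |t| < ε, one has (1 − (1−p−q)t)^2 − 4pqt > 0 and the series Σ_{n≥0} f(n, p, q) t^n converges with sum (1/(2(1−t))) · ( 1 − (1 − (1−p+q)t) / √( (1 − (1−p−q)t)^2 − 4pqt ) ). -/
namespace CoinGF

noncomputable def Sh (d : ℤ) : Module.End ℝ (ℤ → ℝ) := LinearMap.funLeft ℝ ℝ (fun k => k + d)

lemma Sh_pow (d : ℤ) (m : ℕ) (h : ℤ → ℝ) (k : ℤ) : ((Sh d) ^ m) h k = h (k + m * d) := by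
  induction m generalizing k with
  | zero => simp
  | succ m ih =>
    rw [pow_succ', Module.End.mul_apply]
    change ((Sh d) ^ m) h (k + d) = _
    rw [ih]; congr 1; push_cast; ring

lemma bin_pow (d : ℤ) (x y : ℝ) (n : ℕ) (h : ℤ → ℝ) (k : ℤ) :
    ((x • Sh d + y • (1 : Module.End ℝ (ℤ → ℝ))) ^ n) h k =
      ∑ m ∈ Finset.range (n + 1), (n.choose m : ℝ) * x ^ m * y ^ (n - m) * h (k + m * d) := by
  have hc : Commute (x • Sh d) (y • (1 : Module.End ℝ (ℤ → ℝ))) :=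
    ((Commute.one_right (Sh d)).smul_right y).smul_left x
  rw [hc.add_pow, LinearMap.sum_apply, Finset.sum_apply]
  refine Finset.sum_congr rfl fun m _ => ?_
  rw [smul_pow, smul_pow, one_pow, ← nsmul_eq_mul', LinearMap.smul_apply, Pi.smul_apply,
    Module.End.mul_apply, LinearMap.smul_apply, LinearMap.smul_apply, Module.End.one_apply,
    map_smul, Pi.smul_apply, Pi.smul_apply, Sh_pow]
  simp only [smul_eq_mul, nsmul_eq_mul]
  ring

noncomputable def U (p q : ℝ) : Module.End ℝ (ℤ → ℝ) :=
  (p • Sh (-1) + (1 - p) • (1 : Module.End ℝ (ℤ → ℝ))) *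
    (q • Sh 1 + (1 - q) • (1 : Module.End ℝ (ℤ → ℝ)))

lemma U_apply (p q : ℝ) (h : ℤ → ℝ) (k : ℤ) :
    U p q h k = (1 - p - q + 2 * p * q) * h k + q * (1 - p) * h (k + 1)
      + p * (1 - q) * h (k - 1) := by
  change p * (q * h (k + -1 + 1) + (1 - q) * h (k + -1)) +
    (1 - p) * (q * h (k + 1) + (1 - q) * h k) = _
  rw [show k + -1 + 1 = k by ring, ← sub_eq_add_neg]
  ring

noncomputable def g : ℤ → ℝ := fun k => if 0 < k then 1 else 0

lemma f_eq (n : ℕ) (p q : ℝ) : f n p q = ((U p q) ^ n) g 0 := by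
  have hS : Commute (Sh (-1)) (Sh 1) := by
    apply LinearMap.ext; intro h; funext k
    change h (k + -1 + 1) = h (k + 1 + -1)
    congr 1; ring
  have hc : Commute (p • Sh (-1) + (1 - p) • (1 : Module.End ℝ (ℤ → ℝ)))
      (q • Sh 1 + (1 - q) • (1 : Module.End ℝ (ℤ → ℝ))) := by
    apply Commute.add_left
    · apply Commute.add_right
      · exact (hS.smul_right q).smul_left p
      · exact ((Commute.one_right _).smul_right _).smul_left _
    · exact (Commute.one_left _).smul_left _
  rw [U, hc.mul_pow, Module.End.mul_apply, bin_pow, f]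
  refine Finset.sum_congr rfl fun r _ => ?_
  rw [bin_pow, Finset.mul_sum]
  have hs : Finset.Icc (r + 1) n = (Finset.range (n + 1)).filter (fun s => r < s) := by
    ext s; simp only [Finset.mem_Icc, Finset.mem_filter, Finset.mem_range]; omega
  rw [hs, Finset.sum_filter]
  refine Finset.sum_congr rfl fun s _ => ?_
  by_cases h : r < s
  · have : (0 : ℤ) < 0 + r * (-1) + s * 1 := by omega
    simp only [h, if_true, g, this]; ring
  · have : ¬ (0 : ℤ) < 0 + r * (-1) + s * 1 := by omega
    simp only [h, if_false, g, this]; ring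

lemma U_bound (p q : ℝ) (hp : 0 < p) (hp1 : p < 1) (hq : 0 < q) (hq1 : q < 1)
    (h : ℤ → ℝ) (M : ℝ) (hM : ∀ k, |h k| ≤ M) (n : ℕ) : ∀ k, |((U p q) ^ n) h k| ≤ M := by
  induction n with
  | zero => simpa using hM
  | succ n ih =>
    intro k
    rw [pow_succ', Module.End.mul_apply, U_apply]
    have ha : 0 ≤ 1 - p - q + 2 * p * q := by nlinarith
    have hb : 0 ≤ q * (1 - p) := by nlinarith
    have hc : 0 ≤ p * (1 - q) := by nlinarith
    have h0 := abs_le.1 (ih k)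
    have h1 := abs_le.1 (ih (k + 1))
    have h2 := abs_le.1 (ih (k - 1))
    rw [abs_le]
    constructor
    · linarith [mul_le_mul_of_nonneg_left h0.1 ha, mul_le_mul_of_nonneg_left h1.1 hb,
        mul_le_mul_of_nonneg_left h2.1 hc]
    · linarith [mul_le_mul_of_nonneg_left h0.2 ha, mul_le_mul_of_nonneg_left h1.2 hb,
        mul_le_mul_of_nonneg_left h2.2 hc]

lemma main (p q : ℝ) (hp : 0 < p) (hp1 : p < 1) (hq : 0 < q) (hq1 : q < 1) (t : ℝ)
    (ht : |t| < 1) (H : ℤ → ℝ) (M : ℝ) (hM : ∀ k, |H k| ≤ M)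
    (hH : ∀ k, H k = g k + t * U p q H k) :
    HasSum (fun n : ℕ => f n p q * t ^ n) (H 0) := by
  have hH' : H = g + t • U p q H := by
    funext k; simpa using hH k
  have hrem : ∀ N : ℕ, ∑ n ∈ Finset.range N, f n p q * t ^ n
      = H 0 - t ^ N * ((U p q) ^ N) H 0 := by
    intro N
    induction N with
    | zero => simp
    | succ N ih =>
      rw [Finset.sum_range_succ, ih, f_eq]
      have : ((U p q) ^ N) H 0 = ((U p q) ^ N) g 0 + t * ((U p q) ^ (N + 1)) H 0 := by
        conv_lhs => rw [hH']
        rw [map_add, map_smul, pow_succ, Module.End.mul_apply]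
        simp
      rw [this]; ring
  have hgb : ∀ k, |g k| ≤ 1 := by
    intro k; unfold g; split_ifs <;> simp
  have hgeo := summable_geometric_of_lt_one (abs_nonneg t) ht
  have hsum : Summable (fun n : ℕ => f n p q * t ^ n) := by
    refine Summable.of_norm_bounded hgeo fun n => ?_
    rw [Real.norm_eq_abs, abs_mul, abs_pow, f_eq]
    exact mul_le_of_le_one_left (by positivity) (U_bound p q hp hp1 hq hq1 g 1 hgb n 0)
  rw [hsum.hasSum_iff_tendsto_nat]
  simp_rw [hrem]
  have h0 : Filter.Tendsto (fun N : ℕ => t ^ N * ((U p q) ^ N) H 0) Filter.atTop (nhds 0) := by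
    apply squeeze_zero_norm (a := fun N : ℕ => |t| ^ N * M)
    · intro N
      rw [Real.norm_eq_abs, abs_mul, abs_pow]
      exact mul_le_mul_of_nonneg_left (U_bound p q hp hp1 hq hq1 H M hM N 0) (by positivity)
    · simpa using (tendsto_pow_atTop_nhds_zero_of_lt_one (abs_nonneg t) ht).mul_const M
  simpa using h0.const_sub (H 0)

noncomputable def HH (A B C l m : ℝ) : ℤ → ℝ := fun k =>
  if k ≤ 0 then A * l ^ (-k).toNat else C - B * m ^ (k - 1).toNat

lemma HH_neg (A B C l m : ℝ) (k : ℤ) (n : ℕ) (h : k = -n) : HH A B C l m k = A * l ^ n := by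
  have h1 : k ≤ 0 := by omega
  have h2 : (-k).toNat = n := by omega
  simp only [HH, h1, if_true, h2]

lemma HH_pos (A B C l m : ℝ) (k : ℤ) (n : ℕ) (h : k = n + 1) :
    HH A B C l m k = C - B * m ^ n := by
  have h1 : ¬ k ≤ 0 := by omega
  have h2 : (k - 1).toNat = n := by omega
  simp only [HH, h1, if_false, h2]

lemma HH_bound (A B C l m : ℝ) (hl : |l| ≤ 1) (hm : |m| ≤ 1) (k : ℤ) :
    |HH A B C l m k| ≤ |A| + |B| + |C| := by
  unfold HH
  split_ifs
  · rw [abs_mul, abs_pow]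
    have := mul_le_of_le_one_right (abs_nonneg A) (pow_le_one₀ (n := (-k).toNat) (abs_nonneg l) hl)
    linarith [abs_nonneg B, abs_nonneg C]
  · have h1 := abs_sub C (B * m ^ (k - 1).toNat)
    rw [abs_mul, abs_pow] at h1
    have := mul_le_of_le_one_right (abs_nonneg B)
      (pow_le_one₀ (n := (k - 1).toNat) (abs_nonneg m) hm)
    linarith [abs_nonneg A]

lemma HH_eq (A B C l m a b c t K : ℝ) (habc : a + b + c = 1) (hl : K * l = b * t)
    (hm : K * m = c * t) (hK : K * (1 + l * m) = 1 - a * t) (hC : C * (1 - t) = 1)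
    (hA : A = l * (C - B)) (hB : B = m * (C - A)) (k : ℤ) :
    HH A B C l m k = g k + t * (a * HH A B C l m k + b * HH A B C l m (k + 1)
      + c * HH A B C l m (k - 1)) := by
  have ha : a * t = 1 - K * (1 + l * m) := by linarith
  have hC' : C = 1 + C * (a * t + b * t + c * t) := by
    have : a * t + b * t + c * t = t := by rw [← add_mul, ← add_mul, habc, one_mul]
    rw [this]; linarith
  rw [ha, ← hl, ← hm] at hC'
  have key : ∀ x y z w : ℝ, x = w + ((1 - K * (1 + l * m)) * x + K * l * y + K * m * z) →
      x = w + t * (a * x + b * y + c * z) := by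
    intro x y z w h
    rw [← ha, hl, hm] at h
    linarith
  apply key
  have hcase : (∃ n : ℕ, k = -(n + 1)) ∨ k = 0 ∨ k = 1 ∨ ∃ n : ℕ, k = n + 2 := by
    by_cases h1 : k < 0
    · exact Or.inl ⟨(-k - 1).toNat, by omega⟩
    · by_cases h2 : k < 2
      · omega
      · exact Or.inr (Or.inr (Or.inr ⟨(k - 2).toNat, by omega⟩))
  rcases hcase with ⟨n, h⟩ | h | h | ⟨n, h⟩
  · rw [HH_neg A B C l m k (n + 1) (by push_cast; omega), HH_neg A B C l m (k + 1) n (by omega),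
      HH_neg A B C l m (k - 1) (n + 2) (by push_cast; omega)]
    have : ¬ 0 < k := by omega
    simp only [g, this, if_false]; ring
  · rw [HH_neg A B C l m k 0 (by simpa using h), HH_pos A B C l m (k + 1) 0 (by simp [h]),
      HH_neg A B C l m (k - 1) 1 (by simp [h])]
    have : ¬ 0 < k := by omega
    simp only [g, this, if_false]; linear_combination K * hA
  · rw [HH_pos A B C l m k 0 (by simp [h]), HH_pos A B C l m (k + 1) 1 (by simp [h]),
      HH_neg A B C l m (k - 1) 0 (by simp [h])]
    have : 0 < k := by omega
    simp only [g, this, if_true]; linear_combination hC' - K * hB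
  · rw [HH_pos A B C l m k (n + 1) (by push_cast; omega),
      HH_pos A B C l m (k + 1) (n + 2) (by push_cast; omega),
      HH_pos A B C l m (k - 1) n (by omega)]
    have : 0 < k := by omega
    simp only [g, this, if_true]; linear_combination hC'

end CoinGF

open CoinGF in
theorem statement11 (p q : ℝ) (hp : 0 < p) (hp1 : p < 1) (hq : 0 < q) (hq1 : q < 1) :
    ∃ ε : ℝ, 0 < ε ∧ ∀ t : ℝ, |t| < ε →
      0 < (1 - (1 - p - q) * t) ^ 2 - 4 * p * q * t ∧
      HasSum (fun n : ℕ => f n p q * t ^ n)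
        (1 / (2 * (1 - t)) *
          (1 - (1 - (1 - p + q) * t) /
            Real.sqrt ((1 - (1 - p - q) * t) ^ 2 - 4 * p * q * t))) := by
  refine ⟨1 / 4, by norm_num, fun t ht => ?_⟩
  obtain ⟨a, ha⟩ : ∃ a, a = 1 - p - q + 2 * p * q := ⟨_, rfl⟩
  obtain ⟨b, hb⟩ : ∃ b, b = q * (1 - p) := ⟨_, rfl⟩
  obtain ⟨c, hc⟩ : ∃ c, c = p * (1 - q) := ⟨_, rfl⟩
  have habc : a + b + c = 1 := by rw [ha, hb, hc]; ring
  have ha0 : 0 ≤ a := by rw [ha]; nlinarith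
  have hb0 : 0 ≤ b := by rw [hb]; nlinarith
  have hc0 : 0 ≤ c := by rw [hc]; nlinarith
  have hD : (1 - (1 - p - q) * t) ^ 2 - 4 * p * q * t
      = (1 - a * t) ^ 2 - 4 * (b * t) * (c * t) := by rw [ha, hb, hc]; ring
  have habs : ∀ x : ℝ, 0 ≤ x → x ≤ 1 → |x * t| ≤ 1 / 4 := by
    intro x h0 h1
    rw [abs_mul, abs_of_nonneg h0]
    nlinarith [abs_nonneg t]
  have hat := habs a ha0 (by linarith)
  have hbt := habs b hb0 (by linarith)
  have hct := habs c hc0 (by linarith)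
  have hat' := abs_le.1 hat
  have hbc : b * t * (c * t) ≤ 1 / 16 := by
    calc b * t * (c * t) ≤ |b * t * (c * t)| := le_abs_self _
      _ = |b * t| * |c * t| := abs_mul _ _
      _ ≤ 1 / 4 * (1 / 4) := by gcongr
      _ = 1 / 16 := by norm_num
  have hDpos : 0 < (1 - a * t) ^ 2 - 4 * (b * t) * (c * t) := by nlinarith
  rw [hD]
  refine ⟨hDpos, ?_⟩
  obtain ⟨s, hs⟩ : ∃ s, s = Real.sqrt ((1 - a * t) ^ 2 - 4 * (b * t) * (c * t)) := ⟨_, rfl⟩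
  have hs0 : 0 < s := by rw [hs]; exact Real.sqrt_pos.2 hDpos
  have hs2 : s ^ 2 = (1 - a * t) ^ 2 - 4 * (b * t) * (c * t) := by
    rw [hs]; exact Real.sq_sqrt hDpos.le
  rw [← hs]
  obtain ⟨K, hKd⟩ : ∃ K, K = (1 - a * t + s) / 2 := ⟨_, rfl⟩
  have hK14 : 1 / 4 ≤ K := by rw [hKd]; linarith
  have hK0 : 0 < K := by linarith
  obtain ⟨l, hl⟩ : ∃ l, l = b * t / K := ⟨_, rfl⟩
  obtain ⟨m, hm⟩ : ∃ m, m = c * t / K := ⟨_, rfl⟩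
  have hl' : K * l = b * t := by rw [hl]; field_simp
  have hm' : K * m = c * t := by rw [hm]; field_simp
  have hl1 : |l| ≤ 1 := by
    rw [hl, abs_div, abs_of_pos hK0, div_le_one hK0]; linarith
  have hm1 : |m| ≤ 1 := by
    rw [hm, abs_div, abs_of_pos hK0, div_le_one hK0]; linarith
  have hlm : K * (l * m) = (1 - a * t - s) / 2 := by
    have : K * (K * (l * m)) = K * ((1 - a * t - s) / 2) := by
      have h1 : K * (K * (l * m)) = (b * t) * (c * t) := by rw [← hl', ← hm']; ring
      rw [h1, hKd]; linear_combination (1 / 4) * hs2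
    exact mul_left_cancel₀ hK0.ne' this
  have hK1 : K * (1 + l * m) = 1 - a * t := by rw [mul_add, hlm, hKd]; ring
  have hKs : K * (1 - l * m) = s := by rw [mul_sub, hlm, hKd]; ring
  have h1lm : 1 - l * m ≠ 0 := by
    intro h; rw [h] at hKs; linarith
  have ht1 : 1 - t ≠ 0 := by
    have := (abs_lt.1 ht).2
    intro h; linarith
  obtain ⟨C, hC⟩ : ∃ C, C = 1 / (1 - t) := ⟨_, rfl⟩
  obtain ⟨A, hA⟩ : ∃ A, A = l * C * (1 - m) / (1 - l * m) := ⟨_, rfl⟩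
  obtain ⟨B, hB⟩ : ∃ B, B = m * C * (1 - l) / (1 - l * m) := ⟨_, rfl⟩
  have hval : 1 / (2 * (1 - t)) * (1 - (1 - (1 - p + q) * t) / s) = HH A B C l m 0 := by
    rw [HH_neg A B C l m 0 0 (by simp), pow_zero, mul_one, hA]
    have e1 : (1 - p + q) = a + 2 * b := by rw [ha, hb]; ring
    have e2 : l * C * (1 - m) / (1 - l * m) = C * (b * t - (1 - a * t - s) / 2) / s := by
      rw [← hlm, ← hl', ← hKs]
      field_simp
    rw [e1, e2, hC]
    field_simp
    ring
  rw [hval]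
  refine main p q hp hp1 hq hq1 t (by linarith) _ _ (HH_bound A B C l m hl1 hm1) fun k => ?_
  rw [U_apply, ← ha, ← hb, ← hc]
  refine HH_eq A B C l m a b c t K habc hl' hm' hK1 ?_ ?_ ?_ k
  · rw [hC]; field_simp
  · rw [hA, hB]; field_simp; ring
  · have h2 : 1 - m * l ≠ 0 := by rwa [mul_comm m l]
    rw [hA, hB, mul_comm l m]; field_simp; ring
end

section
/- (Strict monotonicity of the indicator in p) For every integer n ≥ 1 and every real q with 0 < q < 1/2, the function p ↦ J_n(q, p) is strictly decreasing on the interval [q, 1−q]: if q ≤ p₁ < p₂ ≤ 1−q then J_n(q, p₂) < J_n(q, p₁). -/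
/-- The indicator function `J n q p = (q/(1−q)) φ_n(z) − ψ_n(z)` with
`z = pq/((1−p)(1−q))`. -/
noncomputable def J (n : ℕ) (q p : ℝ) : ℝ :=
  (q / (1 - q)) * phi n (p * q / ((1 - p) * (1 - q))) -
    psi n (p * q / ((1 - p) * (1 - q)))

noncomputable def auxA (m : ℕ) (z : ℝ) : ℝ :=
  ∑ r ∈ Finset.range (m + 1), (m.choose r : ℝ) ^ 2 * z ^ r

noncomputable def auxB (m : ℕ) (z : ℝ) : ℝ :=
  ∑ r ∈ Finset.range (m + 1), (m.choose r : ℝ) * (m.choose (r + 1) : ℝ) * z ^ r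

theorem aux_choose (m r : ℕ) :
    ((r : ℝ) + 1) * ((m + 1).choose (r + 1) : ℝ) = (m + 1) * (m.choose r : ℝ) := by
  have h := Nat.add_one_mul_choose_eq m r
  have h2 : (((m + 1) * m.choose r : ℕ) : ℝ) = (((m + 1).choose (r + 1) * (r + 1) : ℕ) : ℝ) := by
    rw [h]
  push_cast at h2
  linarith

theorem aux_pascal (m r : ℕ) :
    ((m + 1).choose (r + 1) : ℝ) = (m.choose r : ℝ) + (m.choose (r + 1) : ℝ) := by
  rw [Nat.choose_succ_succ' m r]; push_cast; ring

theorem phi_deriv (m : ℕ) (z : ℝ) :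
    HasDerivAt (phi (m + 1)) ((m + 1) * (auxA m z + auxB m z)) z := by
  have h : HasDerivAt (fun z : ℝ => ∑ r ∈ Finset.range (m + 1 + 1),
      ((m + 1).choose r : ℝ) ^ 2 * z ^ r)
      (∑ r ∈ Finset.range (m + 1 + 1),
      ((m + 1).choose r : ℝ) ^ 2 * ((r : ℝ) * z ^ (r - 1))) z :=
    HasDerivAt.fun_sum fun r _ => (hasDerivAt_pow r z).const_mul _
  change HasDerivAt (phi (m + 1)) _ z at h
  convert  h using 1
  rw [Finset.sum_range_succ']
  simp only [auxA, auxB, ← Finset.sum_add_distrib, Finset.mul_sum]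
  simp only [Nat.cast_zero, zero_mul, mul_zero, add_zero]
  refine Finset.sum_congr rfl fun r _ => ?_
  have h1 := aux_choose m r
  have h2 := aux_pascal m r
  simp only [Nat.add_sub_cancel]
  push_cast
  linear_combination (-(((m + 1).choose (r + 1) : ℝ)) * z ^ r) * h1
    - ((m + 1) * (m.choose r : ℝ) * z ^ r) * h2

theorem psi_deriv (m : ℕ) (z : ℝ) :
    HasDerivAt (psi (m + 1)) ((m + 1) * (auxA m z + z * auxB m z)) z := by
  have h : HasDerivAt (fun z : ℝ => ∑ r ∈ Finset.range (m + 1),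
      ((m + 1).choose (r + 1) : ℝ) * ((m + 1).choose r : ℝ) * z ^ (r + 1))
      (∑ r ∈ Finset.range (m + 1),
      ((m + 1).choose (r + 1) : ℝ) * ((m + 1).choose r : ℝ) *
        (((r + 1 : ℕ) : ℝ) * z ^ (r + 1 - 1))) z :=
    HasDerivAt.fun_sum fun r _ => (hasDerivAt_pow (r + 1) z).const_mul _
  change HasDerivAt (psi (m + 1)) _ z at h
  convert  h using 1
  have e : ∀ r ∈ Finset.range (m + 1), ((m + 1).choose (r + 1) : ℝ) * ((m + 1).choose r : ℝ) *
        (((r + 1 : ℕ) : ℝ) * z ^ (r + 1 - 1)) =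
        (m + 1) * ((m.choose r : ℝ) * ((m + 1).choose r : ℝ) * z ^ r) := by
    intro r _
    have h1 := aux_choose m r
    simp only [Nat.add_sub_cancel]
    push_cast
    linear_combination ((((m + 1).choose r : ℝ)) * z ^ r) * h1
  rw [Finset.sum_congr rfl e, ← Finset.mul_sum]
  congr 1
  have hB : auxB m z = ∑ r ∈ Finset.range m,
      (m.choose r : ℝ) * (m.choose (r + 1) : ℝ) * z ^ r := by
    rw [auxB, Finset.sum_range_succ]; simp
  rw [hB, auxA, Finset.sum_range_succ', Finset.sum_range_succ', Finset.mul_sum,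
    add_right_comm, ← Finset.sum_add_distrib]
  congr 1
  · refine Finset.sum_congr rfl fun r _ => ?_
    rw [aux_pascal m r]; ring
  · simp

theorem aux_AB (m : ℕ) (a z : ℝ) (ha : 0 ≤ a) (hz : a ^ 2 ≤ z) :
    a * auxB m z < auxA m z := by
  have hz0 : 0 ≤ z := le_trans (sq_nonneg a) hz
  have h1 : a * auxB m z ≤ ∑ r ∈ Finset.range (m + 1),
      ((m.choose r : ℝ) ^ 2 * z ^ r + (m.choose (r + 1) : ℝ) ^ 2 * z ^ (r + 1)) / 2 := by
    rw [auxB, Finset.mul_sum]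
    refine Finset.sum_le_sum fun r _ => ?_
    have hp : 0 ≤ z ^ r := pow_nonneg hz0 r
    have k1 := mul_nonneg hp (sq_nonneg ((m.choose r : ℝ) - a * (m.choose (r + 1) : ℝ)))
    have k2 := mul_nonneg hp (mul_nonneg (sub_nonneg.2 hz) (sq_nonneg (m.choose (r + 1) : ℝ)))
    rw [pow_succ z r]
    nlinarith
  rw [← Finset.sum_div, Finset.sum_add_distrib] at h1
  have h2 : auxA m z = ∑ r ∈ Finset.range (m + 1),
      (m.choose (r + 1) : ℝ) ^ 2 * z ^ (r + 1) + 1 := by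
    have h3 := Finset.sum_range_succ (fun r => (m.choose r : ℝ) ^ 2 * z ^ r) (m + 1)
    rw [Finset.sum_range_succ'] at h3
    simp at h3
    rw [auxA]; linarith
  have h4 : auxA m z = ∑ r ∈ Finset.range (m + 1), (m.choose r : ℝ) ^ 2 * z ^ r := rfl
  linarith

theorem aux_anti (m : ℕ) (a : ℝ) (ha : 0 < a) (ha1 : a < 1) :
    StrictAntiOn (fun z => a * phi (m + 1) z - psi (m + 1) z) (Set.Ici (a ^ 2)) := by
  have hd : ∀ z, HasDerivAt (fun z => a * phi (m + 1) z - psi (m + 1) z)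
      (a * ((m + 1) * (auxA m z + auxB m z)) - (m + 1) * (auxA m z + z * auxB m z)) z :=
    fun z => ((phi_deriv m z).const_mul a).sub (psi_deriv m z)
  refine strictAntiOn_of_deriv_neg (convex_Ici _)
    (fun z _ => (hd z).continuousAt.continuousWithinAt) fun z hz => ?_
  rw [interior_Ici] at hz
  have hz' : a ^ 2 ≤ z := le_of_lt hz
  have hz0 : 0 ≤ z := le_trans (sq_nonneg a) hz'
  rw [(hd z).deriv]
  have hAB := aux_AB m a z ha.le hz'
  have hB : 0 ≤ auxB m z := Finset.sum_nonneg fun r _ => by positivity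
  have k1 := mul_pos (sub_pos.2 ha1) (sub_pos.2 hAB)
  have k2 := mul_nonneg (sub_nonneg.2 hz') hB
  have k3 : 0 < (1 - a) * auxA m z + (z - a) * auxB m z := by nlinarith
  have hm : (0 : ℝ) < m + 1 := by positivity
  have := mul_pos hm k3
  nlinarith

theorem statement13 (n : ℕ) (hn : 1 ≤ n) (q : ℝ) (hq : 0 < q) (hq2 : q < 1 / 2) :
    ∀ p₁ p₂ : ℝ, q ≤ p₁ → p₁ < p₂ → p₂ ≤ 1 - q → J n q p₂ < J n q p₁ := by
  intro p₁ p₂ h1 h12 h2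
  obtain ⟨m, rfl⟩ : ∃ m, n = m + 1 := ⟨n - 1, by omega⟩
  have hq1 : 0 < 1 - q := by linarith
  have hp1 : 0 < 1 - p₁ := by linarith
  have hp2 : 0 < 1 - p₂ := by linarith
  have ha : 0 < q / (1 - q) := by positivity
  have ha1 : q / (1 - q) < 1 := by rw [div_lt_one hq1]; linarith
  have e1 : (q / (1 - q)) ^ 2 ≤ p₁ * q / ((1 - p₁) * (1 - q)) := by
    rw [div_pow, div_le_div_iff₀ (by positivity) (by positivity)]
    have := mul_nonneg (mul_pos hq hq1).le (sub_nonneg.2 h1)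
    nlinarith
  have e2 : p₁ * q / ((1 - p₁) * (1 - q)) < p₂ * q / ((1 - p₂) * (1 - q)) := by
    rw [div_lt_div_iff₀ (by positivity) (by positivity)]
    have := mul_pos (mul_pos hq hq1) (sub_pos.2 h12)
    nlinarith
  exact aux_anti m _ ha ha1 e1 (e1.trans e2.le) e2
end

section
/- (Existence and uniqueness of the nullcline) For every integer n ≥ 1 and every real q with 0 < q ≤ n/(2n+1), there exists exactly one real p with q < p ≤ 1−q such that J_n(q, p) = 0. -/
lemma phi_pos (n : ℕ) (x : ℝ) (hx : 0 < x) : 0 < phi n x := by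
  unfold phi
  rw [Finset.sum_range_succ']
  have : 0 ≤ ∑ k ∈ Finset.range n, (n.choose (k + 1) : ℝ) ^ 2 * x ^ (k + 1) :=
    Finset.sum_nonneg (fun i _ => by positivity)
  simp
  linarith

lemma psi_eq (n : ℕ) (x : ℝ) : psi n x =
    ∑ r ∈ Finset.range (n + 1), (n.choose r : ℝ) ^ 2 * ((r : ℝ) / ((n : ℝ) + 1 - r)) * x ^ r := by
  unfold psi
  rw [Finset.sum_range_succ']
  simp only [Nat.cast_zero, zero_div, mul_zero, zero_mul, add_zero]
  apply Finset.sum_congr rfl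
  intro r hr
  rw [Finset.mem_range] at hr
  have h := Nat.choose_succ_right_eq n r
  have h2 : (n.choose (r + 1) : ℝ) * (r + 1) = n.choose r * ((n : ℝ) - r) := by
    rw [← Nat.cast_sub hr.le]
    exact_mod_cast h
  have h3 : (0 : ℝ) < (n : ℝ) - r := by
    have : (r : ℝ) < n := by exact_mod_cast hr
    linarith
  have h4 : (n.choose r : ℝ) = n.choose (r + 1) * ((r + 1) / ((n : ℝ) - r)) := by
    field_simp
    linarith
  rw [h4]
  push_cast
  rw [show (n : ℝ) + 1 - (r + 1) = n - r by ring]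
  ring

lemma cross_pos (n : ℕ) (hn : 1 ≤ n) (x y : ℝ) (hx : 0 < x) (hxy : x < y) :
    0 < psi n y * phi n x - psi n x * phi n y := by
  set s := Finset.range (n + 1) with hs
  set w : ℕ → ℝ := fun r => (n.choose r : ℝ) ^ 2 with hw
  set k : ℕ → ℝ := fun r => (r : ℝ) / ((n : ℝ) + 1 - r) with hk
  have hy : 0 < y := hx.trans hxy
  have e1 : psi n y * phi n x - psi n x * phi n y =
      ∑ i ∈ s, ∑ j ∈ s, w i * w j * k j * (x ^ i * y ^ j - y ^ i * x ^ j) := by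
    rw [psi_eq, psi_eq, mul_comm, mul_comm (∑ r ∈ Finset.range (n + 1), _ * x ^ r)]
    unfold phi
    rw [Finset.sum_mul_sum, Finset.sum_mul_sum, ← Finset.sum_sub_distrib]
    refine Finset.sum_congr rfl fun i _ => ?_
    rw [← Finset.sum_sub_distrib]
    refine Finset.sum_congr rfl fun j _ => ?_
    simp only [hw, hk]
    ring
  have e2 : psi n y * phi n x - psi n x * phi n y =
      ∑ i ∈ s, ∑ j ∈ s, w i * w j * k i * (y ^ i * x ^ j - x ^ i * y ^ j) := by
    rw [e1, Finset.sum_comm]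
    refine Finset.sum_congr rfl fun i _ => ?_
    refine Finset.sum_congr rfl fun j _ => ?_
    ring
  have e3 : 2 * (psi n y * phi n x - psi n x * phi n y) =
      ∑ i ∈ s, ∑ j ∈ s, w i * w j * ((k j - k i) * (x ^ i * y ^ j - y ^ i * x ^ j)) := by
    rw [two_mul]
    nth_rewrite 1 [e1]
    rw [e2, ← Finset.sum_add_distrib]
    refine Finset.sum_congr rfl fun i _ => ?_
    rw [← Finset.sum_add_distrib]
    refine Finset.sum_congr rfl fun j _ => ?_
    ring
  have key : ∀ i j : ℕ, i < j → j ≤ n →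
      0 < (k j - k i) * (x ^ i * y ^ j - y ^ i * x ^ j) := by
    intro i j hij hj
    have hij' : (i : ℝ) < j := by exact_mod_cast hij
    have hj' : (j : ℝ) ≤ n := by exact_mod_cast hj
    apply mul_pos
    · simp only [hk]
      rw [sub_pos, div_lt_div_iff₀ (by linarith) (by linarith)]
      nlinarith
    · obtain ⟨d, rfl⟩ := Nat.exists_eq_add_of_lt hij
      have : x ^ (d + 1) < y ^ (d + 1) := pow_lt_pow_left₀ hxy hx.le (by omega)
      have e : x ^ i * y ^ (i + d + 1) - y ^ i * x ^ (i + d + 1) =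
        x ^ i * y ^ i * (y ^ (d + 1) - x ^ (d + 1)) := by ring
      rw [e]
      have : 0 < y ^ (d + 1) - x ^ (d + 1) := by linarith
      positivity
  have nn : ∀ i ∈ s, ∀ j ∈ s,
      0 ≤ w i * w j * ((k j - k i) * (x ^ i * y ^ j - y ^ i * x ^ j)) := by
    intro i hi j hj
    rw [hs, Finset.mem_range] at hi hj
    apply mul_nonneg (by simp only [hw]; positivity)
    rcases lt_trichotomy i j with h | h | h
    · exact (key i j h (by omega)).le
    · subst h; simp
    · have := key j i h (by omega)
      nlinarith
  have m0 : 0 ∈ s := by simp [hs]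
  have m1 : 1 ∈ s := by simp [hs]; omega
  have pos : 0 < ∑ i ∈ s, ∑ j ∈ s,
      w i * w j * ((k j - k i) * (x ^ i * y ^ j - y ^ i * x ^ j)) := by
    refine Finset.sum_pos' (fun i hi => Finset.sum_nonneg (nn i hi)) ⟨0, m0, ?_⟩
    refine Finset.sum_pos' (nn 0 m0) ⟨1, m1, ?_⟩
    apply mul_pos _ (key 0 1 (by omega) hn)
    have : (0 : ℝ) < n := by exact_mod_cast hn
    simp only [hw, Nat.choose_zero_right, Nat.choose_one_right]
    positivity
  linarith

lemma amgm (n : ℕ) (a : ℝ) (ha : 0 < a) : 0 < a * phi n (a ^ 2) - psi n (a ^ 2) := by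
  have h1 : phi n (a ^ 2) = ∑ r ∈ Finset.range n, (n.choose r : ℝ) ^ 2 * (a ^ 2) ^ r
      + (a ^ 2) ^ n := by
    unfold phi
    rw [Finset.sum_range_succ]
    simp
  have h2 : phi n (a ^ 2) =
      ∑ r ∈ Finset.range n, (n.choose (r + 1) : ℝ) ^ 2 * (a ^ 2) ^ (r + 1) + 1 := by
    unfold phi
    rw [Finset.sum_range_succ']
    simp
  have h3 : 0 ≤ a * ∑ r ∈ Finset.range n, (n.choose r : ℝ) ^ 2 * (a ^ 2) ^ r
      + a * ∑ r ∈ Finset.range n, (n.choose (r + 1) : ℝ) ^ 2 * (a ^ 2) ^ (r + 1)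
      - 2 * psi n (a ^ 2) := by
    unfold psi
    rw [Finset.mul_sum, Finset.mul_sum, Finset.mul_sum, ← Finset.sum_add_distrib,
      ← Finset.sum_sub_distrib]
    refine Finset.sum_nonneg fun r _ => ?_
    have : 0 ≤ a ^ (2 * r + 1) * ((n.choose r : ℝ) - a * n.choose (r + 1)) ^ 2 := by positivity
    refine this.trans_eq ?_
    rw [← pow_mul, ← pow_mul]
    ring
  have h4 : 0 < a * (a ^ 2) ^ n := by positivity
  have h5 : 2 * (a * phi n (a ^ 2)) = a * (∑ r ∈ Finset.range n, (n.choose r : ℝ) ^ 2 * (a ^ 2) ^ r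
      + (a ^ 2) ^ n) + a * (∑ r ∈ Finset.range n,
        (n.choose (r + 1) : ℝ) ^ 2 * (a ^ 2) ^ (r + 1) + 1) := by
    rw [← h1, ← h2]; ring
  linarith

lemma psi_one (n : ℕ) : ((n : ℝ) + 1) * psi n 1 = n * phi n 1 := by
  have h1 : phi n 1 = ((2 * n).choose n : ℝ) := by
    unfold phi
    rw [← Nat.sum_range_choose_sq]
    push_cast
    simp
  have h2 : psi n 1 = ((2 * n).choose (n + 1) : ℝ) := by
    unfold psi
    rw [two_mul, Nat.add_choose_eq, Finset.Nat.sum_antidiagonal_eq_sum_range_succ_mk,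
      Finset.sum_range_succ', Finset.sum_range_succ]
    simp only [Nat.choose_succ_self, tsub_zero, mul_zero, zero_mul, add_zero]
    push_cast
    refine Finset.sum_congr rfl fun r hr => ?_
    rw [Finset.mem_range] at hr
    rw [Nat.choose_symm hr.le]
    simp
  have h3 := Nat.choose_succ_right_eq (2 * n) n
  rw [show 2 * n - n = n by omega] at h3
  have h4 : ((2 * n).choose (n + 1) : ℝ) * (n + 1) = (2 * n).choose n * n := by
    exact_mod_cast h3
  rw [h1, h2]
  linarith

theorem statement14 (n : ℕ) (hn : 1 ≤ n) (q : ℝ) (hq : 0 < q)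
    (hq2 : q ≤ (n : ℝ) / (2 * n + 1)) :
    ∃! p : ℝ, (q < p ∧ p ≤ 1 - q) ∧ J n q p = 0 := by
  have hn0 : (0 : ℝ) < n := by exact_mod_cast hn
  have hq3 : q * (2 * n + 1) ≤ n := (le_div_iff₀ (by positivity)).1 hq2
  have hqh : q < 1 / 2 := by nlinarith
  have h1q : 0 < 1 - q := by linarith
  have ha : 0 < q / (1 - q) := by positivity
  have hJq : 0 < J n q q := by
    have := amgm n (q / (1 - q)) ha
    unfold J
    rwa [show q * q / ((1 - q) * (1 - q)) = (q / (1 - q)) ^ 2 by field_simp]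
  have hJ1 : J n q (1 - q) ≤ 0 := by
    unfold J
    rw [show (1 - q) * q / ((1 - (1 - q)) * (1 - q)) = 1 by
      rw [sub_sub_cancel, mul_comm]; exact div_self (by positivity)]
    have h1 := psi_one n
    have h2 := phi_pos n 1 one_pos
    have h3 : q / (1 - q) ≤ n / (n + 1) := by
      rw [div_le_div_iff₀ h1q (by positivity)]
      linarith
    have h4 : psi n 1 = n / (n + 1) * phi n 1 := by
      field_simp
      linarith
    rw [h4]
    nlinarith
  have hcont : ContinuousOn (J n q) (Set.Icc q (1 - q)) := by
    have hz : ContinuousOn (fun p : ℝ => p * q / ((1 - p) * (1 - q))) (Set.Icc q (1 - q)) := by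
      apply ContinuousOn.div (by fun_prop) (by fun_prop)
      intro p hp
      have : 0 < 1 - p := by linarith [hp.2]
      positivity
    have hphi : Continuous (phi n) := by unfold phi; fun_prop
    have hpsi : Continuous (psi n) := by unfold psi; fun_prop
    unfold J
    exact (continuousOn_const.mul (hphi.comp_continuousOn hz)).sub (hpsi.comp_continuousOn hz)
  have mono : ∀ p₁ p₂ : ℝ, q < p₁ → p₁ < p₂ → p₂ ≤ 1 - q → J n q p₁ = 0 → J n q p₂ = 0 →
      False := by
    intro p₁ p₂ h1 h12 h2 hj1 hj2
    have c1 : 0 < p₁ := by linarith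
    have d1 : 0 < 1 - p₁ := by linarith
    have d2 : 0 < 1 - p₂ := by linarith
    have hx : 0 < p₁ * q / ((1 - p₁) * (1 - q)) := by positivity
    have hxy : p₁ * q / ((1 - p₁) * (1 - q)) < p₂ * q / ((1 - p₂) * (1 - q)) := by
      rw [div_lt_div_iff₀ (by positivity) (by positivity)]
      have : 0 < q * (1 - q) * (p₂ - p₁) := mul_pos (by positivity) (by linarith)
      nlinarith
    have hc := cross_pos n hn _ _ hx hxy
    unfold J at hj1 hj2
    rw [← sub_eq_zero.1 hj1, ← sub_eq_zero.1 hj2] at hc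
    apply hc.ne'
    ring
  obtain ⟨p, hp, hp0⟩ := intermediate_value_Icc' (by linarith) hcont ⟨hJ1, hJq.le⟩
  have hpq : q < p := by
    refine lt_of_le_of_ne hp.1 ?_
    rintro rfl
    exact hJq.ne' hp0
  refine ⟨p, ⟨⟨hpq, hp.2⟩, hp0⟩, ?_⟩
  rintro p' ⟨⟨h1, h2⟩, h3⟩
  rcases lt_trichotomy p' p with h | h | h
  · exact (mono _ _ h1 h hp.2 h3 hp0).elim
  · exact h
  · exact (mono _ _ hpq h h2 hp0 h3).elim
end

section
/- (Explicit first nullcline) For every real q with 0 < q < 1/3, with p = (1−q)/(2−3q) one has q < p < 1−q and J_1(q, p) = 0; equivalently, f(2, p, q) = f(1, p, q). -/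
theorem statement17 (q : ℝ) (hq : 0 < q) (hq3 : q < 1 / 3) (p : ℝ)
    (hp : p = (1 - q) / (2 - 3 * q)) :
    q < p ∧ p < 1 - q ∧ J 1 q p = 0 ∧ f 2 p q = f 1 p q := by
  have h2 : 0 < 2 - 3 * q := by linarith
  have h1 : 0 < 1 - q := by linarith
  have h3 : 0 < 1 - 2 * q := by linarith
  have hm : p * (2 - 3 * q) = 1 - q := by rw [hp, div_mul_cancel₀ _ h2.ne']
  have hp1 : 0 < 1 - p := by
    have : p < 1 := by rw [hp, div_lt_iff₀ h2]; linarith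
    linarith
  have hz : p * q / ((1 - p) * (1 - q)) = q / (1 - 2 * q) := by
    rw [div_eq_div_iff (mul_pos hp1 h1).ne' h3.ne']
    linear_combination q * hm
  refine ⟨?_, ?_, ?_, ?_⟩
  · rw [hp, lt_div_iff₀ h2]; nlinarith [sq_nonneg (2 * q - 1)]
  · rw [hp, div_lt_iff₀ h2]; nlinarith
  · unfold J
    rw [hz]
    simp [phi, psi, Finset.sum_range_succ]
    have e : 1 + q / (1 - 2 * q) = (1 - q) / (1 - 2 * q) := by
      rw [eq_div_iff h3.ne', add_mul, div_mul_cancel₀ _ h3.ne']; ring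
    rw [e, div_mul_div_cancel₀ h1.ne', sub_self]
  · have i1 : Finset.Icc 1 2 = ({1, 2} : Finset ℕ) := by decide
    simp [f, Finset.sum_range_succ, i1]
    linear_combination (-(1 - p) * q) * hm
end

section
/- (Derivative formula for the nullcline) Let n ≥ 1 be an integer and let P : ℝ → ℝ be a function that is differentiable at every point of the open interval I = (0, n/(2n+1)) and satisfies, for every q ∈ I, q < P(q) < 1−q and J_n(q, P(q)) = 0. Then for every q ∈ I, writing p = P(q), one has q(1−q)·(n(q−p)+q) · P'(q) = p(1−p)·(np − nq + p − 1). -/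
lemma phi_psi_deriv (n : ℕ) (z : ℝ) : ∃ A B : ℝ, HasDerivAt (phi n) A z ∧ HasDerivAt (psi n) B z ∧
    z * A = (n + 1) * psi n z - z * B ∧ z * B = z * (n * phi n z - z * A) := by
  have key : ∀ r ∈ Finset.range n,
      (n.choose (r + 1) : ℝ) * ((r : ℝ) + 1) = n.choose r * ((n : ℝ) - r) := by
    intro r hr
    have h := Nat.choose_succ_right_eq n r
    have hr' : r ≤ n := (Finset.mem_range.mp hr).le
    have h2 : ((n.choose (r + 1) * (r + 1) : ℕ) : ℝ) = ((n.choose r * (n - r) : ℕ) : ℝ) := by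
      rw [h]
    push_cast [Nat.cast_sub hr'] at h2
    exact h2
  refine ⟨∑ r ∈ Finset.range (n + 1), (n.choose r : ℝ) ^ 2 * (r * z ^ (r - 1)),
    ∑ r ∈ Finset.range n, (n.choose (r + 1) : ℝ) * (n.choose r : ℝ) * (((r + 1 : ℕ) : ℝ) * z ^ r),
    ?_, ?_, ?_, ?_⟩
  · unfold phi
    exact HasDerivAt.fun_sum fun r _ => (hasDerivAt_pow r z).const_mul _
  · unfold psi
    exact HasDerivAt.fun_sum fun r _ => by
      simpa using (hasDerivAt_pow (r + 1) z).const_mul ((n.choose (r + 1) : ℝ) * (n.choose r : ℝ))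
  · unfold psi
    rw [Finset.sum_range_succ', mul_add, Finset.mul_sum, Finset.mul_sum, Finset.mul_sum,
      ← Finset.sum_sub_distrib]
    simp only [Nat.cast_zero, zero_mul, mul_zero, add_zero]
    refine Finset.sum_congr rfl fun r hr => ?_
    have := key r hr
    push_cast
    try simp only [Nat.add_sub_cancel]
    linear_combination z ^ (r + 1) * (n.choose (r + 1) : ℝ) * this
  · congr 1
    have e : z * ∑ r ∈ Finset.range (n + 1), (n.choose r : ℝ) ^ 2 * (r * z ^ (r - 1))
        = ∑ r ∈ Finset.range (n + 1), (n.choose r : ℝ) ^ 2 * (r * z ^ r) := by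
      rw [Finset.mul_sum]
      refine Finset.sum_congr rfl fun r _ => ?_
      rcases r with _ | r
      · simp
      · simp only [Nat.add_sub_cancel]; ring
    rw [e]
    unfold phi
    rw [Finset.mul_sum, ← Finset.sum_sub_distrib, Finset.sum_range_succ]
    have h0 : (n : ℝ) * ((n.choose n : ℝ) ^ 2 * z ^ n) - (n.choose n : ℝ) ^ 2 * (n * z ^ n) = 0 := by
      ring
    rw [h0, add_zero]
    refine Finset.sum_congr rfl fun r hr => ?_
    have := key r hr
    push_cast
    linear_combination z ^ r * (n.choose r : ℝ) * this

lemma phi_pos' (n : ℕ) (z : ℝ) (hz : 0 < z) : 0 < phi n z := by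
  unfold phi
  refine Finset.sum_pos (fun r hr => ?_) ⟨0, by simp⟩
  have : 0 < n.choose r := Nat.choose_pos (Nat.lt_succ_iff.mp (Finset.mem_range.mp hr))
  positivity

theorem statement18 (n : ℕ) (hn : 1 ≤ n) (P : ℝ → ℝ)
    (hdiff : ∀ q ∈ Set.Ioo (0 : ℝ) ((n : ℝ) / (2 * n + 1)), DifferentiableAt ℝ P q)
    (hrange : ∀ q ∈ Set.Ioo (0 : ℝ) ((n : ℝ) / (2 * n + 1)), q < P q ∧ P q < 1 - q)
    (hnull : ∀ q ∈ Set.Ioo (0 : ℝ) ((n : ℝ) / (2 * n + 1)), J n q (P q) = 0) :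
    ∀ q ∈ Set.Ioo (0 : ℝ) ((n : ℝ) / (2 * n + 1)),
      q * (1 - q) * ((n : ℝ) * (q - P q) + q) * deriv P q =
        P q * (1 - P q) * ((n : ℝ) * P q - (n : ℝ) * q + P q - 1) := by
  intro q hq
  obtain ⟨h1, h2⟩ := hrange q hq
  have hJ := hnull q hq
  have hP := (hdiff q hq).hasDerivAt
  have hev : (fun x => J n x (P x)) =ᶠ[nhds q] fun _ => 0 := by
    filter_upwards [isOpen_Ioo.mem_nhds hq] with x hx using hnull x hx
  have hq0 : 0 < q := hq.1
  have hp0 : 0 < P q := hq0.trans h1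
  have hp1 : 0 < 1 - P q := by linarith
  have hq1 : 0 < 1 - q := by linarith
  generalize deriv P q = D at *
  have hg : HasDerivAt (fun x => P x * x / ((1 - P x) * (1 - x)))
      (P q * q / ((1 - P q) * (1 - q)) * (1 / (q * (1 - q)) + D / (P q * (1 - P q)))) q := by
    have := (hP.mul (hasDerivAt_id' q)).div ((hP.const_sub 1).mul ((hasDerivAt_id' q).const_sub 1))
      (mul_pos hp1 hq1).ne'
    refine this.congr_deriv ?_
    simp only [Pi.mul_apply]
    field_simp
    ring
  have hu : HasDerivAt (fun x : ℝ => x / (1 - x)) (1 / (1 - q) ^ 2) q := by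
    have := (hasDerivAt_id' q).div ((hasDerivAt_id' q).const_sub 1) hq1.ne'
    refine this.congr_deriv ?_
    congr 1
    ring
  obtain ⟨A, B, hA, hB, e1, e2⟩ := phi_psi_deriv n (P q * q / ((1 - P q) * (1 - q)))
  have hJd := (hu.mul (hA.comp q hg)).sub (hB.comp q hg)
  have hE := hJd.unique ((hasDerivAt_const q (0 : ℝ)).congr_of_eventuallyEq hev)
  have hz0 : 0 < P q * q / ((1 - P q) * (1 - q)) := by positivity
  have hf := phi_pos' n _ hz0
  unfold J at hJ
  simp only [Function.comp] at hE
  have hzz : P q * q / ((1 - P q) * (1 - q)) = (q / (1 - q)) * (P q / (1 - P q)) := by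
    field_simp
  generalize P q * q / ((1 - P q) * (1 - q)) = z at *
  generalize phi n z = f at *
  generalize psi n z = s at *
  generalize hL : 1 / (q * (1 - q)) + D / (P q * (1 - P q)) = L at *
  generalize huu : q / (1 - q) = u at *
  have hs : s = u * f := by linarith
  subst hs
  have key : f * ((1 / (1 - q) ^ 2) * (1 - z)
      + (u * ((n + 1) * u - n * z) - z * (n - (n + 1) * u)) * L) = 0 := by
    linear_combination (1 - z) * hE - u * L * (e1 - e2) + L * (e2 - z * e1)
  have key2 := (mul_eq_zero.mp key).resolve_left hf.ne'
  rw [hzz, ← huu, ← hL] at key2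
  generalize P q = p at *
  have hne := hq0.ne'
  have hne1 := hq1.ne'
  have hpe := hp0.ne'
  have hpe1 := hp1.ne'
  field_simp at key2
  linear_combination key2
end
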